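/- Assume the Riemann hypothesis. Then for all real x ≥ e one has Σ_{n ≤ x} (Λ(n)/(n log n)) · (log(x/n)/log x) ≤ log log x + γ − 1 + γ/(log x) + 2|B|/(√x (log x)²), where B = (log 4π)/2 − 1 − γ/2. -/

import Mathlib

/-- The constant `B = (log 4π)/2 − 1 − γ/2 = −0.02309…`. -/
noncomputable def Bconst : ℝ :=
  Real.log (4 * Real.pi) / 2 - 1 - Real.eulerMascheroniConstant / 2

section Helpers

open Complex MeasureTheory Filter Topology Set

/-- The standard decay weight. -/
lemma cz_integrable_weight (r : ℝ) (hr : 1 < r) :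
    Integrable (fun t : ℝ => (1 + ‖t‖) ^ (-r)) := by
  apply integrable_one_add_norm
  simpa using hr

lemma cz_norm_line_im (c t : ℝ) : ‖t‖ ≤ ‖(c : ℂ) + t * I‖ := by
  have := Complex.abs_im_le_norm ((c : ℂ) + t * I)
  simpa using this

lemma cz_norm_line_re (c t : ℝ) : ‖c‖ ≤ ‖(c : ℂ) + t * I‖ := by
  have := Complex.abs_re_le_norm ((c : ℂ) + t * I)
  simpa using this

lemma cz_weight_line (c t : ℝ) :
    (1 + ‖(c : ℂ) + t * I‖) ^ (-(3 / 2) : ℝ) ≤ (1 + ‖t‖) ^ (-(3 / 2) : ℝ) := by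
  apply Real.rpow_le_rpow_of_nonpos
  · positivity
  · linarith [cz_norm_line_im c t]
  · norm_num

/-- A function continuous on a closed vertical line with decay is integrable there. -/
lemma cz_integrable_line {g : ℂ → ℂ} {c C : ℝ}
    (hd : ∀ z : ℂ, z.re = c → ContinuousAt g z)
    (hb : ∀ z : ℂ, z.re = c → ‖g z‖ ≤ C * (1 + ‖z‖) ^ (-(3 / 2) : ℝ)) :
    Integrable (fun t : ℝ => g (c + t * I)) := by
  have hC : 0 ≤ C := by
    have h0 := hb c (by simp)
    by_contra h
    push Not at h
    have : C * (1 + ‖(c : ℂ)‖) ^ (-(3 / 2) : ℝ) < 0 := mul_neg_of_neg_of_pos h (by positivity)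
    linarith [norm_nonneg (g c)]
  refine Integrable.mono' ((cz_integrable_weight (3 / 2) (by norm_num)).const_mul C) ?_ ?_
  · apply Continuous.aestronglyMeasurable
    rw [continuous_iff_continuousAt]
    intro t
    have h1 : ContinuousAt g ((c : ℂ) + t * I) := hd _ (by simp)
    exact ContinuousAt.comp (f := fun t : ℝ => (c : ℂ) + t * I) h1 (by fun_prop)
  · refine Eventually.of_forall fun t => ?_
    refine (hb _ (by simp)).trans ?_
    exact mul_le_mul_of_nonneg_left (cz_weight_line c t) hC

lemma cz_strip_shift {g : ℂ → ℂ} {α β C : ℝ} (hab : α ≤ β)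
    (hd : ∀ z : ℂ, α ≤ z.re → z.re ≤ β → DifferentiableAt ℂ g z)
    (hb : ∀ z : ℂ, α ≤ z.re → z.re ≤ β → ‖g z‖ ≤ C * (1 + ‖z‖) ^ (-(3 / 2) : ℝ)) :
    ∫ t : ℝ, g (α + t * I) = ∫ t : ℝ, g (β + t * I) := by
  have hC : 0 ≤ C := by
    have h0 := hb α (by simp) (by simpa using hab)
    by_contra h
    push Not at h
    have : C * (1 + ‖(α : ℂ)‖) ^ (-(3 / 2) : ℝ) < 0 := mul_neg_of_neg_of_pos h (by positivity)
    linarith [norm_nonneg (g α)]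
  have hia : Integrable (fun t : ℝ => g (α + t * I)) :=
    cz_integrable_line (C := C) (fun z hz => (hd z hz.ge (hz.le.trans hab)).continuousAt)
      (fun z hz => hb z hz.ge (hz.le.trans hab))
  have hib : Integrable (fun t : ℝ => g (β + t * I)) :=
    cz_integrable_line (C := C) (fun z hz => (hd z (hab.trans hz.ge) hz.le).continuousAt)
      (fun z hz => hb z (hab.trans hz.ge) hz.le)
  have ta := intervalIntegral_tendsto_integral hia tendsto_neg_atTop_atBot tendsto_id
  have tb := intervalIntegral_tendsto_integral hib tendsto_neg_atTop_atBot tendsto_id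
  have key : ∀ T : ℝ, 0 < T →
      ‖(∫ t in (-T)..T, g (β + t * I)) - ∫ t in (-T)..T, g (α + t * I)‖ ≤
        2 * (C * (1 + T) ^ (-(3 / 2) : ℝ) * |β - α|) := by
    intro T hT
    have hrect := Complex.integral_boundary_rect_eq_zero_of_differentiableOn g
      ⟨α, -T⟩ ⟨β, T⟩ (by
        intro z hz
        rw [mem_reProdIm] at hz
        simp only [uIcc_of_le hab] at hz
        exact (hd z hz.1.1 hz.1.2).differentiableWithinAt)
    simp only at hrect
    have hside : ∀ y : ℝ, |y| = T →
        ‖∫ x : ℝ in α..β, g (x + y * I)‖ ≤ C * (1 + T) ^ (-(3 / 2) : ℝ) * |β - α| := by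
      intro y hy
      apply intervalIntegral.norm_integral_le_of_norm_le_const
      intro x hx
      rw [uIoc_of_le hab] at hx
      refine (hb _ (by simpa using hx.1.le) (by simpa using hx.2)).trans ?_
      apply mul_le_mul_of_nonneg_left _ hC
      apply Real.rpow_le_rpow_of_nonpos
      · positivity
      · have := cz_norm_line_im x y
        rw [Real.norm_eq_abs, hy] at this
        linarith
      · norm_num
    have h1 := hside (-T) (by rw [abs_neg, abs_of_pos hT])
    have h2 := hside T (abs_of_pos hT)
    have e : (∫ t in (-T)..T, g (β + t * I)) - ∫ t in (-T)..T, g (α + t * I) =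
        (-I) * ((∫ x : ℝ in α..β, g (x + T * I)) - ∫ x : ℝ in α..β, g (x + (-T : ℝ) * I)) := by
      simp only [smul_eq_mul] at hrect
      linear_combination (-I) * hrect + ((∫ t in (-T)..T, g (β + t * I)) - ∫ t in (-T)..T, g (α + t * I)) * (I_mul_I)
    rw [e, norm_mul, norm_neg, norm_I, one_mul]
    refine (norm_sub_le _ _).trans ?_
    linarith
  have tz : Tendsto (fun T : ℝ => 2 * (C * (1 + T) ^ (-(3 / 2) : ℝ) * |β - α|)) atTop (𝓝 0) := by
    have h0 : Tendsto (fun T : ℝ => (1 + T) ^ (-(3 / 2) : ℝ)) atTop (𝓝 0) :=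
      (tendsto_rpow_neg_atTop (by norm_num : (0 : ℝ) < 3 / 2)).comp
        (tendsto_atTop_add_const_left _ _ tendsto_id)
    have := ((h0.const_mul C).mul_const |β - α|).const_mul 2
    simpa using this
  have hz : Tendsto (fun T : ℝ => (∫ t in (-T)..T, g (β + t * I)) -
      ∫ t in (-T)..T, g (α + t * I)) atTop (𝓝 0) :=
    squeeze_zero_norm' ((eventually_gt_atTop 0).mono key) tz
  have := tendsto_nhds_unique hz (tb.sub ta)
  exact (sub_eq_zero.mp this.symm).symm

/-- Extend a bound valid for large `‖z‖` to the full closed half plane. -/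
lemma cz_extend_bound {g : ℂ → ℂ} {α C R e : ℝ}
    (hd : ∀ z : ℂ, α ≤ z.re → ContinuousAt g z)
    (hb : ∀ z : ℂ, α ≤ z.re → R ≤ ‖z‖ → ‖g z‖ ≤ C * (1 + ‖z‖) ^ e) :
    ∃ C' : ℝ, 0 ≤ C' ∧ ∀ z : ℂ, α ≤ z.re → ‖g z‖ ≤ C' * (1 + ‖z‖) ^ e := by
  have hK : IsCompact (Metric.closedBall (0 : ℂ) R ∩ {z | α ≤ z.re}) :=
    (isCompact_closedBall _ _).inter_right (isClosed_le continuous_const continuous_re)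
  have hcont : ContinuousOn (fun z => ‖g z‖ / (1 + ‖z‖) ^ e)
      (Metric.closedBall (0 : ℂ) R ∩ {z | α ≤ z.re}) := by
    intro z hz
    apply ContinuousAt.continuousWithinAt
    apply ContinuousAt.div
    · exact (hd z hz.2).norm
    · apply ContinuousAt.rpow_const (by fun_prop)
      left; positivity
    · positivity
  obtain ⟨M, hM⟩ := hK.bddAbove_image hcont
  refine ⟨max (max M C) 0, le_max_right _ _, fun z hz => ?_⟩
  have hpos : (0 : ℝ) < (1 + ‖z‖) ^ e := by positivity
  by_cases h : ‖z‖ ≤ R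
  · have : ‖g z‖ / (1 + ‖z‖) ^ e ≤ M := hM ⟨z, ⟨by simpa using h, hz⟩, rfl⟩
    rw [div_le_iff₀ hpos] at this
    refine this.trans (mul_le_mul_of_nonneg_right ?_ hpos.le)
    exact (le_max_left _ _).trans (le_max_left _ _)
  · refine (hb z hz (not_le.mp h).le).trans (mul_le_mul_of_nonneg_right ?_ hpos.le)
    exact (le_max_right _ _).trans (le_max_left _ _)

lemma cz_vanish_right {g : ℂ → ℂ} {α C R : ℝ}
    (hd : ∀ z : ℂ, α ≤ z.re → DifferentiableAt ℂ g z)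
    (hb : ∀ z : ℂ, α ≤ z.re → R ≤ ‖z‖ → ‖g z‖ ≤ C * (1 + ‖z‖) ^ (-(3 / 2) : ℝ)) :
    ∫ t : ℝ, g (α + t * I) = 0 := by
  obtain ⟨C', hC', hb'⟩ := cz_extend_bound (fun z hz => (hd z hz).continuousAt) hb
  have hle : ∀ β : ℝ, max α 0 ≤ β → ‖∫ t : ℝ, g (α + t * I)‖ ≤
      (1 + β) ^ (-(1 / 4) : ℝ) * (C' * ∫ t : ℝ, (1 + ‖t‖) ^ (-(5 / 4) : ℝ)) := by
    intro β hβ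
    have hαβ := (le_max_left _ _).trans hβ
    have h0β := (le_max_right _ _).trans hβ
    rw [cz_strip_shift hαβ (fun z h _ => hd z h) (fun z h _ => hb' z h), ← integral_const_mul,
      ← integral_const_mul]
    apply norm_integral_le_of_norm_le
    · exact (((cz_integrable_weight (5 / 4) (by norm_num)).const_mul C').const_mul _)
    · refine Eventually.of_forall fun t => ?_
      refine (hb' _ (by simpa using hαβ)).trans ?_
      have h1 : (1 + ‖(β : ℂ) + t * I‖) ^ (-(3 / 2) : ℝ) ≤
          (1 + β) ^ (-(1 / 4) : ℝ) * (1 + ‖t‖) ^ (-(5 / 4) : ℝ) := by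
        rw [show (-(3 / 2) : ℝ) = -(1 / 4) + -(5 / 4) by norm_num, Real.rpow_add (by positivity)]
        have a1 := cz_norm_line_re β t
        have a2 := cz_norm_line_im β t
        rw [Real.norm_of_nonneg h0β] at a1
        apply mul_le_mul
        · exact Real.rpow_le_rpow_of_nonpos (by positivity) (by linarith) (by norm_num)
        · exact Real.rpow_le_rpow_of_nonpos (by positivity) (by linarith) (by norm_num)
        · positivity
        · positivity
      calc _ ≤ C' * ((1 + β) ^ (-(1 / 4) : ℝ) * (1 + ‖t‖) ^ (-(5 / 4) : ℝ)) :=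
            mul_le_mul_of_nonneg_left h1 hC'
        _ = _ := by ring
  have tz : Tendsto (fun β : ℝ => (1 + β) ^ (-(1 / 4) : ℝ) *
      (C' * ∫ t : ℝ, (1 + ‖t‖) ^ (-(5 / 4) : ℝ))) atTop (𝓝 0) := by
    have h0 : Tendsto (fun T : ℝ => (1 + T) ^ (-(1 / 4) : ℝ)) atTop (𝓝 0) :=
      (tendsto_rpow_neg_atTop (by norm_num : (0 : ℝ) < 1 / 4)).comp
        (tendsto_atTop_add_const_left _ _ tendsto_id)
    simpa using h0.mul_const (C' * ∫ t : ℝ, (1 + ‖t‖) ^ (-(5 / 4) : ℝ))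
  have := ge_of_tendsto tz ((eventually_ge_atTop (max α 0)).mono hle)
  exact norm_le_zero_iff.mp this

lemma cz_reflect (g : ℂ → ℂ) (α : ℝ) :
    ∫ t : ℝ, g (α + t * I) = ∫ t : ℝ, g (-(((-α : ℝ) : ℂ) + t * I)) := by
  rw [← integral_neg_eq_self]
  congr 1
  ext t
  congr 1
  push_cast
  ring

lemma cz_vanish_left {g : ℂ → ℂ} {α C R : ℝ}
    (hd : ∀ z : ℂ, z.re ≤ α → DifferentiableAt ℂ g z)
    (hb : ∀ z : ℂ, z.re ≤ α → R ≤ ‖z‖ → ‖g z‖ ≤ C * (1 + ‖z‖) ^ (-(3 / 2) : ℝ)) :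
    ∫ t : ℝ, g (α + t * I) = 0 := by
  rw [cz_reflect]
  apply cz_vanish_right (g := fun z => g (-z)) (C := C) (R := R)
  · intro z hz
    have h1 : DifferentiableAt ℂ g (-z) := hd _ (by simp; linarith)
    exact DifferentiableAt.comp z h1 (by fun_prop)
  · intro z hz hR
    have := hb (-z) (by simp; linarith) (by simpa using hR)
    simpa using this

lemma cz_int_inv_aux (b t : ℝ) (hb : 0 < b) : (1 / ((b : ℂ) ^ 2 + (t : ℂ) ^ 2)) =
      (((b ^ 2)⁻¹ * (1 + (b⁻¹ * t) ^ 2)⁻¹ : ℝ) : ℂ) := by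
  rw [← ofReal_pow, ← ofReal_pow, ← ofReal_add, ← ofReal_one, ← ofReal_div]
  congr 1
  field_simp

lemma cz_int_inv (b : ℝ) (hb : 0 < b) :
    ∫ t : ℝ, (1 / ((b : ℂ) ^ 2 + (t : ℂ) ^ 2)) = ((Real.pi / b : ℝ) : ℂ) := by
  rw [integral_congr_ae (Eventually.of_forall fun t => cz_int_inv_aux b t hb)]
  rw [integral_complex_ofReal, integral_const_mul]
  have := Measure.integral_comp_mul_left (fun t : ℝ => (1 + t ^ 2)⁻¹) b⁻¹
  rw [this, integral_univ_inv_one_add_sq, inv_inv, abs_of_pos hb, smul_eq_mul]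
  congr 1
  field_simp

lemma cz_integrable_inv (b : ℝ) (hb : 0 < b) :
    Integrable (fun t : ℝ => (1 / ((b : ℂ) ^ 2 + (t : ℂ) ^ 2))) := by
  refine Integrable.congr ?_ (Eventually.of_forall fun t => (cz_int_inv_aux b t hb).symm)
  apply Integrable.ofReal
  apply Integrable.const_mul
  exact integrable_inv_one_add_sq.comp_mul_left' (by positivity)

lemma cz_lower {z q : ℂ} (h : 2 * ‖q‖ + 1 ≤ ‖z‖) : (1 + ‖z‖) / 4 ≤ ‖z - q‖ := by
  have := norm_sub_norm_le z q
  have := norm_nonneg q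
  linarith

lemma cz_poisson_right {N : ℂ → ℂ} {α C R p : ℝ} (hp : α < p)
    (hd : ∀ z : ℂ, α ≤ z.re → DifferentiableAt ℂ N z)
    (hb : ∀ z : ℂ, α ≤ z.re → R ≤ ‖z‖ → ‖N z‖ ≤ C * (1 + ‖z‖) ^ (1 / 2 : ℝ)) :
    ∫ t : ℝ, N (α + t * I) / (((p - α : ℝ) : ℂ) ^ 2 + (t : ℂ) ^ 2) =
      ((Real.pi / (p - α) : ℝ) : ℂ) * N p := by
  set b := p - α with hbdef
  have hb0 : 0 < b := by linarith
  set q : ℂ := p - 2 * b with hq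
  have hqre : q.re < α := by simp [hq, hbdef]; linarith
  let g : ℂ → ℂ := fun z => dslope N p z / (z - q)
  have hgd : ∀ z : ℂ, α ≤ z.re → DifferentiableAt ℂ g z := by
    intro z hz
    apply DifferentiableAt.div
    · by_cases hzp : z = p
      · subst hzp
        have ho : {z : ℂ | α < z.re} ∈ 𝓝 (p : ℂ) :=
          (isOpen_lt continuous_const continuous_re).mem_nhds (by simpa using hp)
        have := (Complex.differentiableOn_dslope (f := N) ho).mpr
          (fun z hz => (hd z (le_of_lt hz)).differentiableWithinAt)
        exact this.differentiableAt ho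
      · exact (differentiableAt_dslope_of_ne hzp).mpr (hd z hz)
    · fun_prop
    · intro h
      rw [sub_eq_zero] at h
      rw [h] at hz
      linarith
  have hgb : ∀ z : ℂ, α ≤ z.re → max R (max (2 * ‖(p : ℂ)‖ + 1) (2 * ‖q‖ + 1)) ≤ ‖z‖ →
      ‖g z‖ ≤ (16 * (|C| + ‖N p‖)) * (1 + ‖z‖) ^ (-(3 / 2) : ℝ) := by
    intro z hz hR
    have h1 := hb z hz ((le_max_left _ _).trans hR)
    have h2 := cz_lower (q := (p : ℂ)) (z := z) ((le_max_left _ _).trans ((le_max_right _ _).trans hR))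
    have h3 := cz_lower (q := q) (z := z) ((le_max_right _ _).trans ((le_max_right _ _).trans hR))
    have hzp : z ≠ p := by
      rintro rfl
      rw [sub_self, norm_zero] at h2
      linarith [norm_nonneg (p : ℂ)]
    have h4 : g z = (N z - N p) / ((z - p) * (z - q)) := by
      simp only [g]
      rw [dslope_of_ne _ hzp, slope_def_field, div_div]
    have h5 : ‖N z - N p‖ ≤ (|C| + ‖N p‖) * (1 + ‖z‖) ^ (1 / 2 : ℝ) := by
      have h6 : (1 : ℝ) ≤ (1 + ‖z‖) ^ (1 / 2 : ℝ) :=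
        Real.one_le_rpow (by linarith [norm_nonneg z]) (by norm_num)
      have h7 : C * (1 + ‖z‖) ^ (1 / 2 : ℝ) ≤ |C| * (1 + ‖z‖) ^ (1 / 2 : ℝ) :=
        mul_le_mul_of_nonneg_right (le_abs_self C) (by linarith)
      have := norm_sub_le (N z) (N p)
      nlinarith [norm_nonneg (N p)]
    have hpos : 0 < 1 + ‖z‖ := by positivity
    rw [h4, norm_div, norm_mul]
    calc ‖N z - N p‖ / (‖z - p‖ * ‖z - q‖)
        ≤ ((|C| + ‖N p‖) * (1 + ‖z‖) ^ (1 / 2 : ℝ)) / ((1 + ‖z‖) / 4 * ((1 + ‖z‖) / 4)) := by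
          gcongr
      _ = (16 * (|C| + ‖N p‖)) * ((1 + ‖z‖) ^ (1 / 2 : ℝ) / (1 + ‖z‖) ^ 2) := by
          field_simp; norm_num
      _ = _ := by
          congr 1
          rw [← Real.rpow_natCast (1 + ‖z‖) 2, ← Real.rpow_sub hpos]
          norm_num
  have hpt : ∀ t : ℝ, (N (α + t * I) - N p) * (1 / ((b : ℂ) ^ 2 + (t : ℂ) ^ 2)) = - g (α + t * I) := by
    intro t
    have hne : (α : ℂ) + t * I ≠ p := by
      intro h
      have := congrArg Complex.re h
      simp at this
      linarith
    have hne1 : (α : ℂ) + t * I - p ≠ 0 := sub_ne_zero.mpr hne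
    have hne2 : (α : ℂ) + t * I - q ≠ 0 := by
      intro h
      have := congrArg Complex.re h
      simp at this
      linarith
    have hprod : ((b : ℂ) ^ 2 + (t : ℂ) ^ 2) = -(((α : ℂ) + t * I - p) * ((α : ℂ) + t * I - q)) := by
      have : (p : ℂ) = α + b := by rw [hbdef]; push_cast; ring
      rw [hq, this]
      ring_nf
      rw [I_sq]
      ring
    simp only [g]
    rw [hprod, dslope_of_ne _ hne, slope_def_field]
    field_simp
  have hv := cz_vanish_right hgd hgb
  obtain ⟨C', hC', hb'⟩ := cz_extend_bound (fun z hz => (hgd z hz).continuousAt) hgb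
  have hint : Integrable (fun t : ℝ => g (α + t * I)) :=
    cz_integrable_line (fun z hz => (hgd z hz.ge).continuousAt) (fun z hz => hb' z hz.ge)
  have hsplit : ∀ t : ℝ, N (α + t * I) / ((b : ℂ) ^ 2 + (t : ℂ) ^ 2) =
      - g (α + t * I) + N p * (1 / ((b : ℂ) ^ 2 + (t : ℂ) ^ 2)) := by
    intro t
    rw [← hpt t]; ring
  have hneg : Integrable (fun t : ℝ => - g (α + t * I)) := hint.neg
  rw [integral_congr_ae (Eventually.of_forall hsplit), integral_add hneg
    ((cz_integrable_inv b hb0).const_mul _), integral_neg, hv, integral_const_mul,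
    cz_int_inv b hb0]
  ring

lemma cz_poisson_left {N : ℂ → ℂ} {α C R p : ℝ} (hp : p < α)
    (hd : ∀ z : ℂ, z.re ≤ α → DifferentiableAt ℂ N z)
    (hb : ∀ z : ℂ, z.re ≤ α → R ≤ ‖z‖ → ‖N z‖ ≤ C * (1 + ‖z‖) ^ (1 / 2 : ℝ)) :
    ∫ t : ℝ, N (α + t * I) / (((α - p : ℝ) : ℂ) ^ 2 + (t : ℂ) ^ 2) =
      ((Real.pi / (α - p) : ℝ) : ℂ) * N p := by
  have := cz_poisson_right (N := fun z => N (-z)) (α := -α) (p := -p) (C := C) (R := R)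
    (by linarith) (by
      intro z hz
      have h1 : DifferentiableAt ℂ N (-z) := hd _ (by simp; linarith)
      exact DifferentiableAt.comp z h1 (by fun_prop)) (by
      intro z hz hR
      have := hb (-z) (by simp; linarith) (by simpa using hR)
      simpa using this)
  rw [show -p - -α = α - p by ring] at this
  rw [show (-((-p : ℝ) : ℂ)) = p by push_cast; ring] at this
  rw [← this, ← integral_neg_eq_self]
  congr 1
  ext t
  congr 2
  · push_cast; ring_nf
  · push_cast; ring

noncomputable def gmTerm (n : ℕ) (s : ℂ) : ℂ := s / ((n : ℂ) + 1) - Complex.log (1 + s / ((n : ℂ) + 1))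

noncomputable def gmSer (s : ℂ) : ℂ := ∑' n : ℕ, gmTerm n s

noncomputable def psTerm (n : ℕ) (s : ℂ) : ℂ := 1 / ((n : ℂ) + 1) - 1 / (s + ((n : ℂ) + 1))

noncomputable def psSer (s : ℂ) : ℂ := ∑' n : ℕ, psTerm n s

lemma gm_re_n (n : ℕ) : ((n : ℂ) + 1).re = (n : ℝ) + 1 := by simp

lemma gm_n_ne (n : ℕ) : ((n : ℂ) + 1) ≠ 0 := by exact_mod_cast Nat.succ_ne_zero n

lemma gm_ne {s : ℂ} (hs : -(1 / 2) < s.re) (n : ℕ) : s + ((n : ℂ) + 1) ≠ 0 := by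
  intro h
  have := congrArg Complex.re h
  simp at this
  have : (0 : ℝ) ≤ n := Nat.cast_nonneg n
  linarith

lemma gm_re_pos {s : ℂ} (hs : -(1 / 2) < s.re) (n : ℕ) : 0 < (1 + s / ((n : ℂ) + 1)).re := by
  have h : s / ((n : ℂ) + 1) = s / (((n : ℝ) + 1 : ℝ) : ℂ) := by push_cast; rfl
  rw [h, add_re, div_ofReal_re, one_re]
  have hn : (0 : ℝ) ≤ n := Nat.cast_nonneg n
  have : -(1 / 2) ≤ s.re / (n + 1) := by
    rw [le_div_iff₀ (by positivity)]
    nlinarith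
  linarith

lemma gm_hasDerivAt_term {s : ℂ} (hs : -(1 / 2) < s.re) (n : ℕ) :
    HasDerivAt (gmTerm n) (psTerm n s) s := by
  have h1 : HasDerivAt (fun s : ℂ => s / ((n : ℂ) + 1)) (1 / ((n : ℂ) + 1)) s :=
    (hasDerivAt_id s).div_const _
  have h2 : HasDerivAt (fun s : ℂ => 1 + s / ((n : ℂ) + 1)) (1 / ((n : ℂ) + 1)) s :=
    h1.const_add 1
  have h3 := h2.clog (Or.inl (gm_re_pos hs n))
  have h4 := h1.sub h3
  have e : psTerm n s = 1 / ((n : ℂ) + 1) - 1 / ((n : ℂ) + 1) / (1 + s / ((n : ℂ) + 1)) := by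
    have a := gm_ne hs n
    have b := gm_n_ne n
    have c : 1 + s / ((n : ℂ) + 1) = (s + ((n : ℂ) + 1)) / ((n : ℂ) + 1) := by
      field_simp; ring
    rw [psTerm, c]
    field_simp
  rw [e]
  exact h4

lemma ps_eq {s : ℂ} (hs : -(1 / 2) < s.re) (n : ℕ) :
    psTerm n s = s / (((n : ℂ) + 1) * (s + ((n : ℂ) + 1))) := by
  have a := gm_ne hs n
  have b := gm_n_ne n
  rw [psTerm]
  field_simp
  ring

lemma ps_norm_n (n : ℕ) : ‖((n : ℂ) + 1)‖ = (n : ℝ) + 1 := by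
  have : ((n : ℂ) + 1) = (((n : ℝ) + 1 : ℝ) : ℂ) := by push_cast; rfl
  rw [this, Complex.norm_of_nonneg (by positivity)]

lemma ps_bound1 {s : ℂ} {R : ℝ} (hs : -(1 / 2) < s.re) (hR : ‖s‖ ≤ R) (n : ℕ) :
    ‖psTerm n s‖ ≤ 2 * R * (1 / ((n : ℝ) + 1) ^ 2) := by
  have h1 : ((n : ℝ) + 1) / 2 ≤ ‖s + ((n : ℂ) + 1)‖ := by
    refine le_trans ?_ (Complex.re_le_norm _)
    simp
    have : (0 : ℝ) ≤ n := Nat.cast_nonneg n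
    linarith
  have hR0 : 0 ≤ R := (norm_nonneg s).trans hR
  rw [ps_eq hs, norm_div, norm_mul, ps_norm_n]
  calc ‖s‖ / (((n : ℝ) + 1) * ‖s + ((n : ℂ) + 1)‖) ≤ R / (((n : ℝ) + 1) * (((n : ℝ) + 1) / 2)) := by
        gcongr
    _ = _ := by field_simp

lemma gm_summable_sq : Summable (fun n : ℕ => 1 / ((n : ℝ) + 1) ^ 2) := by
  have := (summable_nat_add_iff 1).mpr (Real.summable_one_div_nat_pow.mpr (by norm_num : 1 < 2))
  simpa using this

lemma gm_summable_32 : Summable (fun n : ℕ => ((n : ℝ) + 1) ^ (-(3 / 2) : ℝ)) := by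
  have := (summable_nat_add_iff 1).mpr (Real.summable_nat_rpow.mpr (by norm_num : (-(3 / 2) : ℝ) < -1))
  simpa using this

def gmSet (R : ℝ) : Set ℂ := {s : ℂ | -(1 / 2) < s.re} ∩ Metric.ball 0 R

lemma gmSet_open (R : ℝ) : IsOpen (gmSet R) :=
  (isOpen_lt continuous_const continuous_re).inter Metric.isOpen_ball

lemma gmSet_conn (R : ℝ) : IsPreconnected (gmSet R) :=
  ((convex_halfSpace_re_gt _).inter (convex_ball _ _)).isPreconnected

lemma gm_main {s : ℂ} (hs : -(1 / 2) < s.re) :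
    HasDerivAt gmSer (psSer s) s ∧ Summable (fun n => gmTerm n s) := by
  set R := ‖s‖ + 1
  have hu : Summable (fun n : ℕ => 2 * R * (1 / ((n : ℝ) + 1) ^ 2)) := gm_summable_sq.mul_left _
  have hsm : s ∈ gmSet R := ⟨hs, by simp [R]⟩
  have h0 : (0 : ℂ) ∈ gmSet R := ⟨by simp, by simp [R]; positivity⟩
  have hz : Summable fun n => gmTerm n 0 := by simp [gmTerm, summable_zero]
  have hg : ∀ n y, y ∈ gmSet R → HasDerivAt (gmTerm n) (psTerm n y) y :=
    fun n y hy => gm_hasDerivAt_term hy.1 n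
  have hg' : ∀ n y, y ∈ gmSet R → ‖psTerm n y‖ ≤ 2 * R * (1 / ((n : ℝ) + 1) ^ 2) :=
    fun n y hy => ps_bound1 hy.1 (by have := hy.2; simp at this; exact this.le) n
  exact ⟨hasDerivAt_tsum_of_isPreconnected hu (gmSet_open R) (gmSet_conn R) hg hg' h0 hz hsm,
    summable_of_summable_hasDerivAt_of_isPreconnected hu (gmSet_open R) (gmSet_conn R) hg hg' h0 hz hsm⟩

lemma gm_partial {s : ℂ} (hs : 0 < s.re) {N : ℕ} (hN : 0 < N) :
    Complex.exp (-(Real.eulerMascheroniConstant : ℂ) * s + ∑ n ∈ Finset.range N, gmTerm n s) =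
      s * Complex.GammaSeq s N *
        Complex.exp (s * (((harmonic N : ℝ) - Real.log N - Real.eulerMascheroniConstant : ℝ) : ℂ)) := by
  have hs' : -(1 / 2) < s.re := by linarith
  have hs0 : s ≠ 0 := by rintro rfl; simp at hs
  have hexp : ∀ n : ℕ, Complex.exp (gmTerm n s) =
      Complex.exp (s / ((n : ℂ) + 1)) * (((n : ℂ) + 1) / (s + ((n : ℂ) + 1))) := by
    intro n
    have a := gm_ne hs' n
    have b := gm_n_ne n
    have c : 1 + s / ((n : ℂ) + 1) = (s + ((n : ℂ) + 1)) / ((n : ℂ) + 1) := by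
      field_simp; ring
    rw [gmTerm, Complex.exp_sub, Complex.exp_log, c]
    · field_simp
    · rw [c]; exact div_ne_zero a b
  rw [Complex.exp_add, Complex.exp_sum, Finset.prod_congr rfl (fun n _ => hexp n),
    Finset.prod_mul_distrib, ← Complex.exp_sum, Finset.prod_div_distrib, Complex.GammaSeq,
    Finset.prod_range_succ']
  have hfac : ∏ n ∈ Finset.range N, ((n : ℂ) + 1) = (N.factorial : ℂ) := by
    rw [← Finset.prod_range_add_one_eq_factorial]; push_cast; rfl
  have hharm : ∑ n ∈ Finset.range N, s / ((n : ℂ) + 1) = s * ((harmonic N : ℝ) : ℂ) := by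
    rw [harmonic]; push_cast; rw [Finset.mul_sum]
    exact Finset.sum_congr rfl fun n _ => div_eq_mul_inv _ _
  have hpow : (N : ℂ) ^ s = Complex.exp (s * (Real.log N : ℂ)) := by
    rw [Complex.cpow_def_of_ne_zero (by exact_mod_cast hN.ne'), ← Complex.natCast_log, mul_comm]
  have hprod : ∏ n ∈ Finset.range N, (s + (((n + 1 : ℕ)) : ℂ)) = ∏ n ∈ Finset.range N, (s + ((n : ℂ) + 1)) := by
    push_cast; rfl
  have hne : ∏ n ∈ Finset.range N, (s + ((n : ℂ) + 1)) ≠ 0 :=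
    Finset.prod_ne_zero_iff.mpr fun n _ => gm_ne hs' n
  rw [hfac, hharm, hpow, hprod]
  have hE : Complex.exp (-(Real.eulerMascheroniConstant : ℂ) * s) * Complex.exp (s * ((harmonic N : ℝ) : ℂ)) =
      Complex.exp (s * (Real.log N : ℂ)) *
      Complex.exp (s * (((harmonic N : ℝ) - Real.log N - Real.eulerMascheroniConstant : ℝ) : ℂ)) := by
    rw [← Complex.exp_add, ← Complex.exp_add]
    congr 1
    push_cast; ring
  simp only [Nat.cast_zero, add_zero]
  rw [← mul_assoc, hE]
  field_simp

lemma gm_Gamma {s : ℂ} (hs : 0 < s.re) :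
    Complex.exp (-(Real.eulerMascheroniConstant : ℂ) * s + gmSer s) = s * Complex.Gamma s := by
  have h1 : Tendsto (fun N : ℕ => Complex.exp (-(Real.eulerMascheroniConstant : ℂ) * s +
      ∑ n ∈ Finset.range N, gmTerm n s)) atTop
      (𝓝 (Complex.exp (-(Real.eulerMascheroniConstant : ℂ) * s + gmSer s))) := by
    apply (Complex.continuous_exp.tendsto _).comp
    exact ((gm_main (by linarith)).2.hasSum.tendsto_sum_nat).const_add _
  have h2 : Tendsto (fun N : ℕ => s * Complex.GammaSeq s N *
        Complex.exp (s * (((harmonic N : ℝ) - Real.log N - Real.eulerMascheroniConstant : ℝ) : ℂ)))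
      atTop (𝓝 (s * Complex.Gamma s * Complex.exp (s * ((0 : ℝ) : ℂ)))) := by
    apply Tendsto.mul
    · exact (Complex.GammaSeq_tendsto_Gamma s).const_mul s
    · apply (Complex.continuous_exp.tendsto _).comp
      apply Tendsto.const_mul
      apply (Complex.continuous_ofReal.tendsto _).comp
      have := Real.tendsto_harmonic_sub_log.sub_const Real.eulerMascheroniConstant
      simpa using this
  have h3 := tendsto_nhds_unique (h1.congr' ((eventually_gt_atTop 0).mono
    fun N hN => gm_partial hs hN)) h2
  simpa using h3

lemma gm_logDeriv {s : ℂ} (hs : 0 < s.re) :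
    logDeriv Complex.Gamma s = -(Real.eulerMascheroniConstant : ℂ) - 1 / s + psSer s := by
  have hs0 : s ≠ 0 := by rintro rfl; simp at hs
  have hd : HasDerivAt (fun w : ℂ => Complex.exp (-(Real.eulerMascheroniConstant : ℂ) * w + gmSer w) / w)
      ((Complex.exp (-(Real.eulerMascheroniConstant : ℂ) * s + gmSer s) *
        (-(Real.eulerMascheroniConstant : ℂ) + psSer s) * s -
        Complex.exp (-(Real.eulerMascheroniConstant : ℂ) * s + gmSer s) * 1) / s ^ 2) s := by
    apply HasDerivAt.div _ (hasDerivAt_id s) hs0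
    apply HasDerivAt.cexp
    have h1 : HasDerivAt (fun y : ℂ => -(Real.eulerMascheroniConstant : ℂ) * y)
        (-(Real.eulerMascheroniConstant : ℂ)) s := by
      simpa using (hasDerivAt_id s).const_mul (-(Real.eulerMascheroniConstant : ℂ))
    exact h1.add (gm_main (s := s) (by linarith)).1
  have he : Complex.Gamma =ᶠ[𝓝 s] fun w : ℂ => Complex.exp (-(Real.eulerMascheroniConstant : ℂ) * w + gmSer w) / w := by
    filter_upwards [(isOpen_lt continuous_const continuous_re).mem_nhds hs] with w hw
    have hw0 : w ≠ 0 := by rintro rfl; simp at hw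
    rw [gm_Gamma hw]; field_simp
  have hd' := hd.congr_of_eventuallyEq he
  have hG : Complex.Gamma s ≠ 0 := Complex.Gamma_ne_zero_of_re_pos hs
  rw [logDeriv_apply, hd'.deriv, gm_Gamma hs]
  field_simp
  ring

noncomputable def psK : ℝ := ∑' n : ℕ, ((n : ℝ) + 1) ^ (-(3 / 2) : ℝ)

lemma psK_nonneg : 0 ≤ psK := tsum_nonneg fun n => by positivity

lemma ps_bound2 {s : ℂ} (hs : 0 ≤ s.re) (n : ℕ) :
    ‖psTerm n s‖ ≤ ‖s‖ ^ (1 / 2 : ℝ) * ((n : ℝ) + 1) ^ (-(3 / 2) : ℝ) := by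
  rcases eq_or_ne s 0 with rfl | hs0
  · simp [psTerm]
  have hm : (0 : ℝ) < (n : ℝ) + 1 := by positivity
  set m : ℝ := (n : ℝ) + 1
  have hsp : 0 < ‖s‖ := norm_pos_iff.mpr hs0
  rw [ps_eq (by linarith), norm_div, norm_mul, ps_norm_n]
  have h1 : ‖s‖ * m ≤ ‖s + ((n : ℂ) + 1)‖ ^ 2 := by
    rw [← Complex.normSq_eq_norm_sq, Complex.normSq_apply]
    have h2 : ‖s‖ ^ 2 = s.re * s.re + s.im * s.im := by
      rw [← Complex.normSq_eq_norm_sq, Complex.normSq_apply]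
    simp only [add_re, natCast_re, one_re, add_im, natCast_im, one_im]
    have : s.re + ((n : ℝ) + 1) = s.re + m := rfl
    rw [this]
    nlinarith [sq_nonneg (‖s‖ - m), mul_nonneg hs hm.le]
  have h3 : ‖s‖ ^ (1 / 2 : ℝ) * m ^ (1 / 2 : ℝ) ≤ ‖s + ((n : ℂ) + 1)‖ := by
    rw [← Real.mul_rpow hsp.le hm.le, ← Real.sqrt_eq_rpow]
    exact Real.sqrt_le_iff.mpr ⟨norm_nonneg _, h1⟩
  have h4 : ‖s‖ = ‖s‖ ^ (1 / 2 : ℝ) * ‖s‖ ^ (1 / 2 : ℝ) := by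
    rw [← Real.rpow_add hsp]; norm_num
  have h5 : m ^ (-(3 / 2) : ℝ) = 1 / (m * m ^ (1 / 2 : ℝ)) := by
    rw [Real.rpow_neg hm.le, ← Real.rpow_one_add' hm.le (by norm_num)]
    norm_num
  calc ‖s‖ / (m * ‖s + ((n : ℂ) + 1)‖) ≤ ‖s‖ / (m * (‖s‖ ^ (1 / 2 : ℝ) * m ^ (1 / 2 : ℝ))) := by
        gcongr
    _ = _ := by
        rw [h5]
        have : 0 < ‖s‖ ^ (1 / 2 : ℝ) := by positivity
        nth_rw 1 [h4]
        field_simp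

lemma ps_summable {s : ℂ} (hs : 0 ≤ s.re) : Summable (fun n => psTerm n s) :=
  Summable.of_norm_bounded (gm_summable_32.mul_left _) (ps_bound2 hs)

lemma ps_bound {s : ℂ} (hs : 0 ≤ s.re) : ‖psSer s‖ ≤ psK * ‖s‖ ^ (1 / 2 : ℝ) := by
  rw [mul_comm]
  exact tsum_of_norm_bounded (gm_summable_32.hasSum.mul_left _) (ps_bound2 hs)

lemma gm_bound {s : ℂ} (hs : 0 ≤ s.re) : ‖gmSer s‖ ≤ psK * ‖s‖ ^ (3 / 2 : ℝ) := by
  have hconv : Convex ℝ ({z : ℂ | 0 ≤ z.re} ∩ Metric.closedBall 0 ‖s‖) :=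
    (convex_halfSpace_re_ge 0).inter (convex_closedBall _ _)
  have h := hconv.norm_image_sub_le_of_norm_hasDerivWithin_le (f := gmSer) (f' := psSer)
    (C := psK * ‖s‖ ^ (1 / 2 : ℝ)) (x := 0) (y := s)
    (fun z hz => (gm_main (by have := hz.1; simp at this; linarith)).1.hasDerivWithinAt)
    (fun z hz => (ps_bound hz.1).trans (by
      have := hz.2
      simp at this
      have := psK_nonneg
      gcongr)) ⟨by simp, by simp⟩ ⟨hs, by simp⟩
  have h0 : gmSer 0 = 0 := by simp [gmSer, gmTerm]
  rw [h0, sub_zero, sub_zero] at h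
  refine h.trans (le_of_eq ?_)
  rw [mul_assoc]
  congr 1
  rcases eq_or_ne s 0 with rfl | hs0
  · norm_num
  nth_rw 2 [← Real.rpow_one ‖s‖]
  rw [← Real.rpow_add (norm_pos_iff.mpr hs0)]
  norm_num

noncomputable def xi (s : ℂ) : ℂ := s * (s - 1) * completedRiemannZeta₀ s + 1

lemma xi_diff : Differentiable ℂ xi := by
  unfold xi
  have := differentiable_completedZeta₀
  fun_prop

lemma xi_one_sub (s : ℂ) : xi (1 - s) = xi s := by
  unfold xi
  rw [completedRiemannZeta₀_one_sub]; ring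

lemma xi_eq {s : ℂ} (hs : 0 < s.re) (h1 : s ≠ 1) :
    xi s = s * (s - 1) * (Gammaℝ s * riemannZeta s) := by
  have hs0 : s ≠ 0 := by rintro rfl; simp at hs
  have hs1 : s - 1 ≠ 0 := sub_ne_zero.mpr h1
  have hs1' : 1 - s ≠ 0 := sub_ne_zero.mpr h1.symm
  rw [riemannZeta_def_of_ne_zero hs0, mul_div_cancel₀ _ (Gammaℝ_ne_zero_of_re_pos hs),
    completedRiemannZeta_eq, xi]
  field_simp
  ring

lemma xi_one : xi 1 = 1 := by simp [xi]

lemma xi_ne (RH : RiemannHypothesis) {s : ℂ} (hs : 1 / 2 < s.re) : xi s ≠ 0 := by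
  rcases eq_or_ne s 1 with rfl | h1
  · simp [xi_one]
  have hs0 : s ≠ 0 := by rintro rfl; simp at hs; linarith
  rw [xi_eq (by linarith) h1]
  refine mul_ne_zero (mul_ne_zero hs0 (sub_ne_zero.mpr h1)) (mul_ne_zero
    (Gammaℝ_ne_zero_of_re_pos (by linarith)) fun h => ?_)
  have := RH s h (by
    rintro ⟨n, rfl⟩
    have : ((-2 * ((n : ℂ) + 1))).re = -2 * ((n : ℝ) + 1) := by simp
    rw [this] at hs
    have : (0 : ℝ) ≤ n := n.cast_nonneg
    linarith) h1
  linarith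

lemma xi_conj_aux {s : ℂ} (hs : 0 < s.re) :
    xi ((starRingEnd ℂ) s) = (starRingEnd ℂ) (xi s) := by
  rcases eq_or_ne s 1 with rfl | h1
  · simp [xi_one]
  have h1' : (starRingEnd ℂ) s ≠ 1 := fun h => h1 (by
    have := congrArg (starRingEnd ℂ) h; simpa using this)
  rw [xi_eq hs h1, xi_eq (by simpa using hs) h1', riemannZeta_conj]
  simp only [map_mul, map_sub, map_one]
  congr 2
  rw [Gammaℝ_def, Gammaℝ_def, map_mul, ← Complex.Gamma_conj]
  congr 1
  · have : (Real.pi : ℂ).arg ≠ Real.pi := by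
      rw [Complex.arg_ofReal_of_nonneg Real.pi_pos.le]; exact Real.pi_pos.ne
    have h2 : -(starRingEnd ℂ) s / 2 = (starRingEnd ℂ) (-s / 2) := by
      simp [map_div₀, Complex.conj_ofNat]
    rw [h2, Complex.cpow_conj _ _ this, Complex.conj_ofReal]
  · rw [map_div₀, Complex.conj_ofNat]

lemma xi_conj (s : ℂ) : xi ((starRingEnd ℂ) s) = (starRingEnd ℂ) (xi s) := by
  rcases lt_or_ge 0 s.re with h | h
  · exact xi_conj_aux h
  · have := xi_conj_aux (s := 1 - s) (by simp; linarith)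
    rw [xi_one_sub] at this
    rw [← this, map_sub, map_one, xi_one_sub]

lemma xi_deriv_one : deriv xi 1 = ((-Bconst : ℝ) : ℂ) := by
  have h1 : HasDerivAt (fun s : ℂ => s * (s - 1)) 1 1 := by
    exact ((hasDerivAt_id (1:ℂ)).mul ((hasDerivAt_id (1:ℂ)).sub_const 1)).congr_deriv (by simp)
  have h2 := (h1.mul (differentiable_completedZeta₀ 1).hasDerivAt).add_const (1 : ℂ)
  have h3 : HasDerivAt xi (completedRiemannZeta₀ 1) 1 := h2.congr_deriv (by simp)
  rw [h3.deriv, completedRiemannZeta₀_one, Bconst]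
  have : Complex.log (4 * (Real.pi : ℂ)) = ((Real.log (4 * Real.pi) : ℝ) : ℂ) := by
    rw [Complex.ofReal_log (by positivity)]; simp
  rw [this]
  push_cast
  ring

lemma cz0_strip : ∃ C : ℝ, 0 ≤ C ∧ ∀ s : ℂ, -1 ≤ s.re → s.re ≤ 4 → ‖completedRiemannZeta₀ s‖ ≤ C := by
  set P := HurwitzZeta.hurwitzEvenFEPair 0 with hP
  have hc : ∀ s : ℂ, MellinConvergent P.f_modif s := fun s =>
    (P.isStrongFEPair_toStrongFEPair.hasMellin s).1
  have hN : ∀ (s : ℂ) (t : ℝ), t ∈ Ioi (0:ℝ) →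
      ‖(t : ℂ) ^ (s - 1) • P.f_modif t‖ = t ^ (s.re - 1) * ‖P.f_modif t‖ := by
    intro s t ht
    rw [norm_smul, Complex.norm_cpow_eq_rpow_re_of_pos ht]; simp
  set D : ℝ := ∫ t in Ioi (0:ℝ), (‖(t : ℂ) ^ ((-1 / 2 : ℂ) - 1) • P.f_modif t‖ +
      ‖(t : ℂ) ^ ((2 : ℂ) - 1) • P.f_modif t‖) with hD
  have hD0 : 0 ≤ D := integral_nonneg fun t => by positivity
  refine ⟨D / 2, by positivity, fun s h1 h2 => ?_⟩
  have : completedRiemannZeta₀ s = mellin P.f_modif (s / 2) / 2 := rfl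
  rw [this, norm_div, Complex.norm_ofNat]
  gcongr
  rw [mellin]
  refine (norm_integral_le_integral_norm _).trans ?_
  refine setIntegral_mono_on (hc _).norm ((hc _).norm.add (hc _).norm) measurableSet_Ioi ?_
  intro t ht
  have ht0 : 0 < t := ht
  rw [hN _ _ ht, hN _ _ ht, hN _ _ ht, ← add_mul]
  gcongr
  have e1 : (s / 2).re = s.re / 2 := by simp
  have e2 : ((-1 / 2 : ℂ)).re = -1 / 2 := by simp
  have e3 : ((2 : ℂ)).re = 2 := by simp
  rw [e1, e2, e3]
  rcases le_total t 1 with h | h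
  · have := Real.rpow_le_rpow_of_exponent_ge ht0 h (show (-1/2 - 1 : ℝ) ≤ s.re / 2 - 1 by linarith)
    exact this.trans (le_add_of_nonneg_right (by positivity))
  · have := Real.rpow_le_rpow_of_exponent_le h (show s.re / 2 - 1 ≤ (2 - 1 : ℝ) by linarith)
    exact this.trans (le_add_of_nonneg_left (by positivity))

noncomputable def zZ : ℝ := ∑' n, ‖LSeries.term 1 2 n‖

lemma zZ_summable : Summable fun n => ‖LSeries.term 1 2 n‖ :=
  (LSeriesSummable_one_iff.mpr (by norm_num : 1 < (2:ℂ).re)).norm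

lemma zZ_bound {f : ℕ → ℂ} (hf : ∀ n, ‖f n‖ ≤ 1) {s : ℂ} (hs : 2 ≤ s.re) :
    ‖LSeries f s‖ ≤ zZ := by
  refine tsum_of_norm_bounded zZ_summable.hasSum fun n => ?_
  refine (LSeries.norm_term_le_of_re_le_re f (by simpa using hs : (2:ℂ).re ≤ s.re) n).trans ?_
  exact LSeries.norm_term_le 2 (by simpa using hf n)

lemma zeta_ub {s : ℂ} (hs : 2 ≤ s.re) : ‖riemannZeta s‖ ≤ zZ := by
  rw [← LSeries_one_eq_riemannZeta (by linarith)]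
  exact zZ_bound (by simp) hs

lemma zeta_lb {s : ℂ} (hs : 2 ≤ s.re) : 1 ≤ ‖riemannZeta s‖ * zZ := by
  have h := ArithmeticFunction.LSeries_zeta_mul_Lseries_moebius (s := s) (by linarith)
  rw [ArithmeticFunction.LSeries_zeta_eq_riemannZeta (by linarith)] at h
  have h2 := congrArg norm h
  rw [norm_mul, norm_one] at h2
  rw [← h2]
  gcongr
  refine zZ_bound (fun n => ?_) hs
  have := ArithmeticFunction.abs_moebius_le_one (n := n)
  rw [Complex.norm_intCast]
  exact_mod_cast this

lemma zZ_pos : 1 ≤ zZ := by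
  have h1 := zeta_ub (s := 2) (by simp)
  have h2 := zeta_lb (s := 2) (by simp)
  have h0 : 0 ≤ zZ := (norm_nonneg _).trans h1
  nlinarith [norm_nonneg (riemannZeta 2)]

lemma zeta_log {s : ℂ} (hs : 2 ≤ s.re) : |Real.log ‖riemannZeta s‖| ≤ Real.log zZ := by
  have h1 := zeta_ub hs
  have h2 := zeta_lb hs
  have hz := zZ_pos
  have h0 : 0 < ‖riemannZeta s‖ := by
    by_contra h
    push Not at h
    nlinarith [norm_nonneg (riemannZeta s)]
  rw [abs_le]
  constructor
  · have := Real.log_nonneg h2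
    rw [Real.log_mul h0.ne' (by linarith)] at this
    linarith
  · exact Real.log_le_log h0 h1

lemma xi_log : ∃ C : ℝ, 0 ≤ C ∧ ∀ s : ℂ, 2 ≤ s.re → xi s ≠ 0 ∧
    |Real.log ‖xi s‖| ≤ C * (1 + ‖s‖) ^ (3 / 2 : ℝ) := by
  have hlz : 0 ≤ Real.log zZ := Real.log_nonneg zZ_pos
  have hK := psK_nonneg
  refine ⟨1 + Real.log 2 + |Real.log Real.pi| + |Real.eulerMascheroniConstant| + psK
    + Real.log zZ, by have := Real.log_nonneg (one_le_two); positivity, fun s hs => ?_⟩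
  have hs1 : s ≠ 1 := by rintro rfl; norm_num at hs
  have hs0 : s ≠ 0 := by rintro rfl; norm_num at hs
  have h2 : (0:ℝ) < (s / 2).re := by simp; linarith
  have hz0 : riemannZeta s ≠ 0 := riemannZeta_ne_zero_of_one_lt_re (by linarith)
  have key : xi s = (s - 1) * 2 * ((Real.pi : ℂ) ^ (-s / 2)) *
      Complex.exp (-(Real.eulerMascheroniConstant : ℂ) * (s / 2) + gmSer (s / 2)) * riemannZeta s := by
    rw [xi_eq (by linarith) hs1, gm_Gamma h2, Gammaℝ_def]
    ring
  have hpi : ‖(Real.pi : ℂ) ^ (-s / 2)‖ = Real.pi ^ (-s.re / 2) := by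
    rw [Complex.norm_cpow_eq_rpow_re_of_pos Real.pi_pos]; simp
  have hne : xi s ≠ 0 := by
    rw [key]
    have : (Real.pi : ℂ) ^ (-s / 2) ≠ 0 := by
      rw [← norm_ne_zero_iff, hpi]; have := Real.pi_pos; positivity
    have : s - 1 ≠ 0 := sub_ne_zero.mpr hs1
    simp_all
  refine ⟨hne, ?_⟩
  have hsn : 2 ≤ ‖s‖ := hs.trans (Complex.re_le_norm s)
  have hs1n : 1 ≤ ‖s - 1‖ := by
    have := Complex.re_le_norm (s - 1); simp at this; linarith
  have hs1u : ‖s - 1‖ ≤ 1 + ‖s‖ := by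
    have := norm_sub_le s 1; simp at this; linarith
  have hlog : Real.log ‖xi s‖ = Real.log ‖s - 1‖ + Real.log 2 + (-s.re / 2) * Real.log Real.pi
      + (-(Real.eulerMascheroniConstant : ℂ) * (s / 2) + gmSer (s / 2)).re
      + Real.log ‖riemannZeta s‖ := by
    have hpp := Real.pi_pos
    rw [key, norm_mul, norm_mul, norm_mul, norm_mul, hpi, Complex.norm_exp, Complex.norm_ofNat,
      Real.log_mul, Real.log_mul, Real.log_mul, Real.log_mul, Real.log_exp, Real.log_rpow hpp]
    all_goals positivity
  rw [hlog]
  set Y := (1 + ‖s‖) ^ (3 / 2 : ℝ) with hY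
  have hY1 : 1 + ‖s‖ ≤ Y := Real.self_le_rpow_of_one_le (by linarith) (by norm_num)
  have b1 : |Real.log ‖s - 1‖| ≤ Y := by
    rw [abs_of_nonneg (Real.log_nonneg hs1n)]
    have := Real.log_le_sub_one_of_pos (by linarith : 0 < ‖s - 1‖)
    linarith
  have hl2 : 0 ≤ Real.log 2 := Real.log_nonneg one_le_two
  have b2 : |Real.log 2| ≤ Real.log 2 * Y := by
    rw [abs_of_nonneg hl2]; nlinarith
  have hre := Complex.re_le_norm s
  have b3 : |(-s.re / 2) * Real.log Real.pi| ≤ |Real.log Real.pi| * Y := by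
    rw [abs_mul, mul_comm]
    gcongr
    rw [abs_le]; constructor <;> linarith
  have b4 : |(-(Real.eulerMascheroniConstant : ℂ) * (s / 2) + gmSer (s / 2)).re|
      ≤ |Real.eulerMascheroniConstant| * Y + psK * Y := by
    refine (Complex.abs_re_le_norm _).trans ((norm_add_le _ _).trans (add_le_add ?_ ?_))
    · rw [norm_mul, norm_neg, Complex.norm_real, Real.norm_eq_abs, norm_div, Complex.norm_ofNat]
      gcongr; linarith
    · refine (gm_bound h2.le).trans ?_
      rw [hY, norm_div, Complex.norm_ofNat]
      gcongr; linarith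
  have b5 := zeta_log hs
  have b5' : Real.log zZ ≤ Real.log zZ * Y := by nlinarith
  rw [abs_le] at *
  constructor <;> nlinarith

lemma xi_ub : ∃ C : ℝ, 0 ≤ C ∧ ∀ s : ℂ, 0 ≤ s.re →
    ‖xi s‖ ≤ Real.exp (C * (1 + ‖s‖) ^ (3 / 2 : ℝ)) := by
  obtain ⟨C1, hC1, h1⟩ := cz0_strip
  obtain ⟨C2, hC2, h2⟩ := xi_log
  refine ⟨C1 + 3 + C2, by positivity, fun s hs => ?_⟩
  have hY1 : 1 + ‖s‖ ≤ (1 + ‖s‖) ^ (3 / 2 : ℝ) :=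
    Real.self_le_rpow_of_one_le (by linarith [norm_nonneg s]) (by norm_num)
  have hn := norm_nonneg s
  rcases le_total s.re 2 with h | h
  · have hb := h1 s (by linarith) (by linarith)
    have a1 : ‖xi s‖ ≤ (C1 + 1) * (1 + ‖s‖) ^ 2 := by
      have : ‖xi s‖ ≤ ‖s‖ * (‖s‖ + 1) * C1 + 1 := by
        rw [xi]
        refine (norm_add_le _ _).trans ?_
        rw [norm_mul, norm_mul, norm_one]
        gcongr
        have := norm_sub_le s 1; simpa using this
      nlinarith [mul_nonneg hC1 hn]
    have a2 : C1 + 1 ≤ Real.exp C1 := Real.add_one_le_exp _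
    have a3 : 1 + ‖s‖ ≤ Real.exp (1 + ‖s‖) := by linarith [Real.add_one_le_exp (1 + ‖s‖)]
    calc ‖xi s‖ ≤ Real.exp C1 * (Real.exp (1 + ‖s‖)) ^ 2 := by
          refine a1.trans ?_; gcongr
      _ = Real.exp (C1 + 2 * (1 + ‖s‖)) := by
          rw [Real.exp_add C1, two_mul, Real.exp_add (1 + ‖s‖) (1 + ‖s‖), sq]
      _ ≤ _ := by
          apply Real.exp_le_exp.mpr
          nlinarith
  · obtain ⟨hne, hl⟩ := h2 s h
    rw [← Real.log_le_iff_le_exp (norm_pos_iff.mpr hne)]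
    refine (le_abs_self _).trans (hl.trans ?_)
    gcongr; linarith

lemma hol_log {f : ℂ → ℂ} {c : ℂ} {R : ℝ} (hR : 0 < R) (hf : ∀ z ∈ Metric.ball c R, DifferentiableAt ℂ f z)
    (h0 : ∀ z ∈ Metric.ball c R, f z ≠ 0) :
    ∃ g : ℂ → ℂ, g c = 0 ∧ (∀ z ∈ Metric.ball c R, DifferentiableAt ℂ g z) ∧
      ∀ z ∈ Metric.ball c R, f z = f c * Complex.exp (g z) := by
  have hfo : DifferentiableOn ℂ f (Metric.ball c R) := fun z hz => (hf z hz).differentiableWithinAt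
  have h1 : DifferentiableOn ℂ (fun z => deriv f z / f z) (Metric.ball c R) :=
    (hfo.deriv Metric.isOpen_ball).div hfo h0
  obtain ⟨g, hg0, hg⟩ := h1.isExactOn_ball.with_val_at c 0
  refine ⟨g, hg0, fun z hz => (hg z hz).differentiableAt, fun z hz => ?_⟩
  have hd : ∀ w ∈ Metric.ball c R, HasDerivAt (fun w => f w * Complex.exp (-g w)) 0 w := by
    intro w hw
    have := (hf w hw).hasDerivAt.mul ((hg w hw).neg.cexp)
    refine this.congr_deriv ?_
    have := h0 w hw
    simp only [Pi.neg_apply]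
    field_simp
    ring
  have hc := Metric.isOpen_ball.is_const_of_deriv_eq_zero (f := fun w => f w * Complex.exp (-g w))
    (convex_ball c R).isPreconnected (fun w hw => (hd w hw).differentiableAt.differentiableWithinAt)
    (fun w hw => (hd w hw).deriv) hz (Metric.mem_ball_self hR)
  simp only [hg0, neg_zero, Complex.exp_zero, mul_one] at hc
  rw [← hc, mul_assoc, ← Complex.exp_add]; simp

lemma xi_lb (RH : RiemannHypothesis) {h : ℝ} (hh : 0 < h) : ∃ C : ℝ, 0 ≤ C ∧ ∀ s : ℂ, 1 / 2 + h ≤ s.re →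
    Real.exp (-(C * (1 + ‖s‖) ^ (3 / 2 : ℝ))) ≤ ‖xi s‖ := by
  obtain ⟨C1, hC1, h1⟩ := xi_ub
  obtain ⟨C2, hC2, h2⟩ := xi_log
  refine ⟨8 * C2 + 3 * (8 * C1 + 8 * C2 + 1) / h, by positivity, fun s hs => ?_⟩
  have hn := norm_nonneg s
  set Y := (1 + ‖s‖) ^ (3 / 2 : ℝ) with hY
  have hY1 : 1 ≤ Y := Real.one_le_rpow (by linarith) (by norm_num)
  have hCC : 0 ≤ 3 * (8 * C1 + 8 * C2 + 1) / h * Y := by positivity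
  rcases le_total 2 s.re with h' | h'
  · obtain ⟨hne, hl⟩ := h2 s h'
    rw [← Real.le_log_iff_exp_le (norm_pos_iff.mpr hne)]
    have := (abs_le.mp hl).1
    nlinarith
  · set z0 : ℂ := 2 + s.im * I with hz0
    have hz0r : z0.re = 2 := by simp [hz0]
    have hz0s : s - z0 = ((s.re - 2 : ℝ) : ℂ) := by
      apply Complex.ext <;> simp [hz0]
    have hw : ‖s - z0‖ = 2 - s.re := by
      rw [hz0s, Complex.norm_real, Real.norm_eq_abs, abs_of_nonpos (by linarith)]; ring
    have h8 : ∀ z : ℂ, ‖z‖ ≤ ‖s‖ + 3 → (1 + ‖z‖) ^ (3 / 2 : ℝ) ≤ 8 * Y := by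
      intro z hz
      have : (8 : ℝ) = 4 ^ (3 / 2 : ℝ) := by
        rw [show (4:ℝ) = 2 ^ (2:ℝ) by norm_num, ← Real.rpow_mul (by norm_num)]; norm_num
      rw [this, hY, ← Real.mul_rpow (by norm_num) (by linarith)]
      gcongr
      linarith
    have hz0n : ‖z0‖ ≤ ‖s‖ + 3 / 2 := by
      have := norm_sub_norm_le z0 s
      rw [norm_sub_rev] at this
      linarith
    obtain ⟨hne, hl⟩ := h2 z0 hz0r.ge
    have hl' : -(C2 * (8 * Y)) ≤ Real.log ‖xi z0‖ := by
      refine le_trans ?_ (abs_le.mp hl).1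
      have := h8 z0 (by linarith)
      gcongr
    have hball : ∀ z ∈ Metric.ball (0:ℂ) (3 / 2), 1 / 2 < (z0 + z).re ∧ ‖z0 + z‖ ≤ ‖s‖ + 3 := by
      intro z hz
      have hz' : ‖z‖ < 3 / 2 := by simpa using hz
      have := (abs_le.mp (Complex.abs_re_le_norm z)).1
      constructor
      · rw [Complex.add_re, hz0r]; linarith
      · exact (norm_add_le _ _).trans (by linarith)
    obtain ⟨g, hg0, hgd, hg⟩ := hol_log (f := fun z => xi (z0 + z)) (c := 0) (R := 3 / 2) (by norm_num)
      (fun z _ => (xi_diff (z0 + z)).comp z (by fun_prop))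
      (fun z hz => xi_ne RH (hball z hz).1)
    simp only [add_zero] at hg
    have hre : ∀ z ∈ Metric.ball (0:ℂ) (3 / 2), (g z).re = Real.log ‖xi (z0 + z)‖ - Real.log ‖xi z0‖ := by
      intro z hz
      rw [hg z hz, norm_mul, Complex.norm_exp, Real.log_mul (by simpa using hne) (Real.exp_pos _).ne',
        Real.log_exp]
      ring
    set M := (8 * C1 + 8 * C2 + 1) * Y with hM
    have hMp : 0 < M := by positivity
    have hbc := Complex.borelCaratheodory_zero (f := g) (R := 3 / 2) (z := s - z0) hMp
      (fun z hz => (hgd z hz).differentiableWithinAt) (fun z hz => by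
        simp only [Set.mem_ofPred_eq]
        rw [hre z hz]
        have e1 : Real.log ‖xi (z0 + z)‖ ≤ C1 * (8 * Y) := by
          rw [Real.log_le_iff_le_exp (norm_pos_iff.mpr (xi_ne RH (hball z hz).1))]
          refine (h1 _ (by linarith [(hball z hz).1])).trans ?_
          gcongr
          exact h8 _ (hball z hz).2
        nlinarith) (by norm_num) (by simp [hw]; linarith) hg0
    have hzm : s - z0 ∈ Metric.ball (0:ℂ) (3 / 2) := by simp [hw]; linarith
    have hgs := hre _ hzm
    rw [add_sub_cancel] at hgs
    have hgl : -(3 * M / h) ≤ (g (s - z0)).re := by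
      have a := (abs_le.mp (Complex.abs_re_le_norm (g (s - z0)))).1
      have b : 2 * M * ‖s - z0‖ / (3 / 2 - ‖s - z0‖) ≤ 3 * M / h := by
        rw [hw]
        apply div_le_div₀ (by positivity) (by nlinarith) hh (by linarith)
      linarith
    rw [← Real.le_log_iff_exp_le (norm_pos_iff.mpr (xi_ne RH (by linarith)))]
    have : 3 * M / h = 3 * (8 * C1 + 8 * C2 + 1) / h * Y := by rw [hM]; ring
    rw [this] at hgl
    linarith

lemma xi_real_bdd {h : ℝ} (h0 : 0 < h) (h1 : h < 1 / 2) :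
    ∃ K : ℝ, ∀ x : ℝ, 8 ≤ x → ‖xi (1 / 2 + x - h) / xi (1 / 2 + x + h)‖ ≤ K := by
  have hpp := Real.pi_pos
  refine ⟨Real.pi * zZ * zZ, fun x hx => ?_⟩
  have form : ∀ y : ℝ, 6 ≤ y → ‖xi y‖ = y * (y - 1) * (Real.pi ^ (-y / 2) * Real.Gamma (y / 2) * ‖riemannZeta y‖) := by
    intro y hy
    rw [xi_eq (by simp; linarith) (by
      intro h; have := congrArg Complex.re h; simp at this; linarith), Gammaℝ_def]
    simp only [norm_mul]
    rw [Complex.norm_cpow_eq_rpow_re_of_pos hpp, show (y:ℂ) / 2 = ((y / 2 : ℝ) : ℂ) by push_cast; ring,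
      Complex.Gamma_ofReal, Complex.norm_real, Complex.norm_real,
      show (y:ℂ) - 1 = ((y - 1 : ℝ) : ℂ) by push_cast; ring, Complex.norm_real]
    rw [Real.norm_of_nonneg (by linarith), Real.norm_of_nonneg (by linarith : 0 ≤ y - 1),
      Real.norm_of_nonneg (Real.Gamma_pos_of_pos (by linarith)).le]
    simp
  have e1 : (1 / 2 + x - h : ℂ) = ((1 / 2 + x - h : ℝ) : ℂ) := by push_cast; ring
  have e2 : (1 / 2 + x + h : ℂ) = ((1 / 2 + x + h : ℝ) : ℂ) := by push_cast; ring
  rw [e1, e2, norm_div, form _ (by linarith), form _ (by linarith)]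
  set a := 1 / 2 + x - h with ha
  set b := 1 / 2 + x + h with hb
  have hab : a ≤ b := by linarith
  have ha6 : 6 ≤ a := by linarith
  have hzb : 0 < ‖riemannZeta b‖ := by
    have := zeta_lb (s := b) (by simp; linarith)
    by_contra h
    push Not at h
    nlinarith [norm_nonneg (riemannZeta b), zZ_pos]
  have hGb : 0 < Real.Gamma (b / 2) := Real.Gamma_pos_of_pos (by linarith)
  have hGa : 0 < Real.Gamma (a / 2) := Real.Gamma_pos_of_pos (by linarith)
  have hb1 : 0 < b - 1 := by linarith
  have ha1 : 0 < a - 1 := by linarith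
  have hb0 : 0 < b := by linarith
  have ha0 : 0 < a := by linarith
  rw [div_le_iff₀ (by positivity)]
  have g1 : Real.Gamma (a / 2) ≤ Real.Gamma (b / 2) := by
    apply Real.Gamma_strictMonoOn_Ici.monotoneOn
    · simp only [Set.mem_Ici]; linarith
    · simp only [Set.mem_Ici]; linarith
    · linarith
  have g2 : a * (a - 1) ≤ b * (b - 1) := by nlinarith
  have g3 : Real.pi ^ (-a / 2) ≤ Real.pi * Real.pi ^ (-b / 2) := by
    rw [← Real.rpow_one_add' hpp.le (by linarith)]
    apply Real.rpow_le_rpow_of_exponent_le (by linarith [Real.pi_gt_three])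
    linarith
  have g4 : ‖riemannZeta a‖ ≤ zZ * zZ * ‖riemannZeta b‖ := by
    have u := zeta_ub (s := a) (by simp; linarith)
    have l := zeta_lb (s := b) (by simp; linarith)
    nlinarith [zZ_pos]
  calc a * (a - 1) * (Real.pi ^ (-a / 2) * Real.Gamma (a / 2) * ‖riemannZeta a‖)
      ≤ (b * (b - 1)) * ((Real.pi * Real.pi ^ (-b / 2)) * Real.Gamma (b / 2) * (zZ * zZ * ‖riemannZeta b‖)) := by
        gcongr
    _ = _ := by ring

lemma xi_mono (RH : RiemannHypothesis) {h : ℝ} (h0 : 0 < h) (h1 : h < 1 / 2) {z : ℂ} (hz : 0 ≤ z.re) :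
    ‖xi (1 / 2 + z - h) / xi (1 / 2 + z + h)‖ ≤ 1 := by
  obtain ⟨C1, hC1, hub⟩ := xi_ub
  obtain ⟨C2, hC2, hlb⟩ := xi_lb RH h0
  have hne : ∀ z : ℂ, 0 ≤ z.re → xi (1 / 2 + z + h) ≠ 0 := fun z hz => xi_ne RH (by simp; linarith)
  have hxi := xi_diff
  refine PhragmenLindelof.right_half_plane_of_bounded_on_real
    (f := fun z => xi (1 / 2 + z - h) / xi (1 / 2 + z + h)) ?_ ⟨3 / 2, by norm_num,
    (C1 + C2) * 2 ^ (3 / 2 : ℝ), ?_⟩ ?_ ?_ hz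
  · apply DifferentiableOn.diffContOnCl
    rw [Complex.closure_setOfPred_lt_re]
    intro w hw
    apply DifferentiableAt.differentiableWithinAt
    have d1 : DifferentiableAt ℂ (fun z : ℂ => xi (1 / 2 + z - h)) w := (hxi _).comp w (by fun_prop)
    have d2 : DifferentiableAt ℂ (fun z : ℂ => xi (1 / 2 + z + h)) w := (hxi _).comp w (by fun_prop)
    exact d1.div d2 (hne w hw)
  · apply Asymptotics.IsBigO.of_bound 1
    rw [eventually_inf_principal]
    filter_upwards [eventually_cobounded_le_norm (2:ℝ)] with w hw hwr
    have hwr' : 0 < w.re := hwr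
    rw [one_mul, Real.norm_of_nonneg (Real.exp_pos _).le, norm_div]
    have n1 : 1 + ‖1 / 2 + w - h‖ ≤ 2 * ‖w‖ := by
      have : (1 / 2 + w - h : ℂ) = w + ((1 / 2 - h : ℝ) : ℂ) := by push_cast; ring
      rw [this]
      have := norm_add_le w ((1 / 2 - h : ℝ) : ℂ)
      rw [Complex.norm_real, Real.norm_of_nonneg (by linarith)] at this
      linarith
    have n2 : 1 + ‖1 / 2 + w + h‖ ≤ 2 * ‖w‖ := by
      have : (1 / 2 + w + h : ℂ) = w + ((1 / 2 + h : ℝ) : ℂ) := by push_cast; ring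
      rw [this]
      have := norm_add_le w ((1 / 2 + h : ℝ) : ℂ)
      rw [Complex.norm_real, Real.norm_of_nonneg (by linarith)] at this
      linarith
    have u := hub (1 / 2 + w - h) (by simp; linarith)
    have l := hlb (1 / 2 + w + h) (by simp; linarith)
    have p1 : (1 + ‖1 / 2 + w - h‖) ^ (3 / 2 : ℝ) ≤ (2 * ‖w‖) ^ (3 / 2 : ℝ) := by gcongr
    have p2 : (1 + ‖1 / 2 + w + h‖) ^ (3 / 2 : ℝ) ≤ (2 * ‖w‖) ^ (3 / 2 : ℝ) := by gcongr
    rw [div_le_iff₀ (norm_pos_iff.mpr (hne w hwr'.le))]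
    refine u.trans (le_trans ?_ (mul_le_mul_of_nonneg_left l (Real.exp_pos _).le))
    rw [← Real.exp_add, Real.exp_le_exp]
    rw [mul_assoc, ← Real.mul_rpow (by norm_num) (norm_nonneg _)]
    nlinarith
  · obtain ⟨K, hK⟩ := xi_real_bdd h0 h1
    exact ⟨K, by
      simp only [eventually_map]
      filter_upwards [eventually_ge_atTop 8] with x hx using hK x hx⟩
  · intro t
    have e : (1 / 2 + (t:ℂ) * I - h) = 1 - (starRingEnd ℂ) (1 / 2 + (t:ℂ) * I + h) := by
      apply Complex.ext <;> simp <;> ring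
    rw [e, xi_one_sub, xi_conj, norm_div, Complex.norm_conj, div_self]
    exact norm_ne_zero_iff.mpr (hne _ (by simp))

lemma xi_re_nonneg (RH : RiemannHypothesis) {s : ℂ} (hs : 1 / 2 < s.re) : 0 ≤ (logDeriv xi s).re := by
  have hne := xi_ne RH hs
  have hd := (xi_diff s).hasDerivAt
  have hf : HasDerivAt (fun h : ℝ => xi (s - h) / xi (s + h)) (-2 * logDeriv xi s) 0 := by
    have a1 : HasDerivAt (fun h : ℝ => s - (h:ℂ)) (-1) 0 := by
      simpa using (Complex.ofRealCLM.hasDerivAt (x := 0)).const_sub s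
    have a2 : HasDerivAt (fun h : ℝ => s + (h:ℂ)) 1 0 := by
      simpa using (Complex.ofRealCLM.hasDerivAt (x := 0)).const_add s
    have b1 : HasDerivAt (fun h : ℝ => xi (s - h)) (deriv xi s * (-1)) 0 :=
      HasDerivAt.comp (h₂ := xi) (0:ℝ) (h₂' := deriv xi s) (by rw [ofReal_zero, sub_zero]; exact hd) a1
    have b2 : HasDerivAt (fun h : ℝ => xi (s + h)) (deriv xi s * 1) 0 :=
      HasDerivAt.comp (h₂ := xi) (0:ℝ) (h₂' := deriv xi s) (by rw [ofReal_zero, add_zero]; exact hd) a2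
    refine (b1.div b2 (by simpa using hne)).congr_deriv ?_
    simp [logDeriv_apply]
    field_simp
    ring
  have hr : HasDerivAt (fun h : ℝ => (xi (s - h) / xi (s + h)).re) (-2 * (logDeriv xi s).re) 0 := by
    have := Complex.reCLM.hasFDerivAt.comp_hasDerivAt (0:ℝ) hf
    refine this.congr_deriv ?_
    simp
  have hle : -2 * (logDeriv xi s).re ≤ 0 := by
    have := hr.hasDerivWithinAt (s := Ioi 0)
    rw [hasDerivWithinAt_iff_tendsto_slope' (by simp)] at this
    refine le_of_tendsto this ?_
    filter_upwards [Ioo_mem_nhdsGT (show (0:ℝ) < 1 / 2 by norm_num)] with h hh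
    rw [slope_def_field]
    apply div_nonpos_of_nonpos_of_nonneg _ (by linarith [hh.1])
    have := xi_mono RH hh.1 hh.2 (z := s - 1 / 2) (by simp; linarith)
    rw [add_sub_cancel] at this
    have h2 := (Complex.re_le_norm _).trans this
    simp [hne]
    linarith
  linarith

noncomputable def xG (z : ℂ) : ℂ := logDeriv xi (z + 1 / 2)

noncomputable def xA (z : ℂ) : ℂ :=
  -((Real.log Real.pi : ℝ) : ℂ) / 2 - (Real.eulerMascheroniConstant : ℂ) / 2 + psSer ((z + 1 / 2) / 2) / 2

lemma xG_diff (RH : RiemannHypothesis) {z : ℂ} (hz : 0 < z.re) : DifferentiableAt ℂ xG z := by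
  have hd : Differentiable ℂ (deriv xi) :=
    (differentiableOn_univ.mp (xi_diff.differentiableOn.deriv isOpen_univ))
  have hx := xi_diff
  have hne : xi (z + 1 / 2) ≠ 0 := xi_ne RH (by simp; linarith)
  have d1 : DifferentiableAt ℂ (fun w => deriv xi (w + 1 / 2)) z := (hd _).comp z (by fun_prop)
  have d2 : DifferentiableAt ℂ (fun w => xi (w + 1 / 2)) z := (hx _).comp z (by fun_prop)
  exact d1.div d2 hne

lemma xG_conj (z : ℂ) : xG ((starRingEnd ℂ) z) = (starRingEnd ℂ) (xG z) := by
  have h : (starRingEnd ℂ) ∘ xi ∘ (starRingEnd ℂ) = xi := by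
    ext s; simp [xi_conj]
  have h2 : ∀ s, deriv xi ((starRingEnd ℂ) s) = (starRingEnd ℂ) (deriv xi s) := by
    intro s
    have := congrFun (deriv_conj_conj (f := xi)) ((starRingEnd ℂ) s)
    rw [h] at this
    rw [this]; simp
  have e : (starRingEnd ℂ) z + 1 / 2 = (starRingEnd ℂ) (z + 1 / 2) := by
    apply Complex.ext <;> simp
  rw [xG, xG, logDeriv_apply, logDeriv_apply, e, h2, xi_conj, map_div₀]

lemma xG_re (RH : RiemannHypothesis) {z : ℂ} (hz : 0 < z.re) : 0 ≤ (xG z).re :=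
  xi_re_nonneg RH (by simp; linarith)

lemma xG_half (RH : RiemannHypothesis) : xG (1 / 2) = ((|Bconst| : ℝ) : ℂ) := by
  have h1 : xG (1 / 2) = ((-Bconst : ℝ) : ℂ) := by
    rw [xG, logDeriv_apply]
    norm_num [xi_one, xi_deriv_one]
  have h2 := xG_re RH (z := 1 / 2) (by simp)
  rw [h1, ofReal_re] at h2
  rw [h1, abs_of_nonpos (by linarith)]

lemma psSer_diff {s : ℂ} (hs : -(1 / 2) < s.re) : DifferentiableAt ℂ psSer s := by
  have ho : IsOpen {s : ℂ | -(1 / 2) < s.re} := isOpen_lt continuous_const continuous_re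
  have h1 : DifferentiableOn ℂ gmSer {s : ℂ | -(1 / 2) < s.re} := fun w hw =>
    (gm_main hw).1.differentiableAt.differentiableWithinAt
  have h2 := (h1.deriv ho).differentiableAt (ho.mem_nhds hs)
  refine h2.congr_of_eventuallyEq ?_
  filter_upwards [ho.mem_nhds hs] with w hw
  exact (gm_main hw).1.deriv.symm

lemma xA_diff {z : ℂ} (hz : -(1 / 2) ≤ z.re) : DifferentiableAt ℂ xA z := by
  have h : DifferentiableAt ℂ (fun z => psSer ((z + 1 / 2) / 2)) z := by
    refine DifferentiableAt.comp z (psSer_diff ?_) (by fun_prop)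
    simp; linarith
  unfold xA
  exact (differentiableAt_const _).add (h.div_const 2)

lemma xA_bound : ∃ C : ℝ, 0 ≤ C ∧ ∀ z : ℂ, -(1 / 2) ≤ z.re → ‖xA z‖ ≤ C * (1 + ‖z‖) ^ (1 / 2 : ℝ) := by
  refine ⟨‖-((Real.log Real.pi : ℝ) : ℂ) / 2 - (Real.eulerMascheroniConstant : ℂ) / 2‖ + psK,
    by have := psK_nonneg; positivity, fun z hz => ?_⟩
  have hY : 1 ≤ (1 + ‖z‖) ^ (1 / 2 : ℝ) := Real.one_le_rpow (by linarith [norm_nonneg z]) (by norm_num)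
  refine (norm_add_le _ _).trans ?_
  rw [add_mul]
  apply add_le_add
  · exact le_mul_of_one_le_right (norm_nonneg _) hY
  · rw [norm_div, Complex.norm_ofNat]
    have h1 := ps_bound (s := (z + 1 / 2) / 2) (by simp; linarith)
    have h2 : ‖(z + 1 / 2) / 2‖ ≤ 1 + ‖z‖ := by
      rw [norm_div, Complex.norm_ofNat]
      have := norm_add_le z (1 / 2)
      norm_num at this
      linarith [norm_nonneg z]
    have h3 : psK * ‖(z + 1 / 2) / 2‖ ^ (1 / 2 : ℝ) ≤ psK * (1 + ‖z‖) ^ (1 / 2 : ℝ) := by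
      have := psK_nonneg
      gcongr
    linarith [norm_nonneg (psSer ((z + 1 / 2) / 2))]

lemma xG_eq {z : ℂ} (hz : 1 / 2 < z.re) :
    xG z = xA z + 1 / (z - 1 / 2) + logDeriv riemannZeta (z + 1 / 2) := by
  set s := z + 1 / 2 with hs
  have hsr : 1 < s.re := by simp [hs]; linarith
  have hs0 : s ≠ 0 := by intro h; rw [h] at hsr; norm_num at hsr
  have hs1 : s ≠ 1 := by intro h; rw [h] at hsr; norm_num at hsr
  have hs1' : s - 1 ≠ 0 := sub_ne_zero.mpr hs1
  have hz0 : riemannZeta s ≠ 0 := riemannZeta_ne_zero_of_one_lt_re hsr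
  have hs2 : 0 < (s / 2).re := by simp; linarith
  have hG0 := Complex.Gamma_ne_zero_of_re_pos hs2
  have hpi : (Real.pi : ℂ) ≠ 0 := by exact_mod_cast Real.pi_ne_zero
  have hpw : (Real.pi : ℂ) ^ (-s / 2) ≠ 0 := by simp [Complex.cpow_eq_zero_iff, hpi]
  have he : xi =ᶠ[𝓝 s] fun w => w * (w - 1) * ((Real.pi : ℂ) ^ (-w / 2) * Complex.Gamma (w / 2) * riemannZeta w) := by
    filter_upwards [(isOpen_lt continuous_const continuous_re).mem_nhds hsr] with w hw
    have hw' : 1 < w.re := hw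
    rw [xi_eq (by linarith) (by rintro rfl; norm_num at hw'), Gammaℝ_def]
  have d1 : HasDerivAt (fun w : ℂ => w * (w - 1)) (1 * (s - 1) + s * 1) s :=
    (hasDerivAt_id s).mul ((hasDerivAt_id s).sub_const 1)
  have d2 : HasDerivAt (fun w : ℂ => (Real.pi : ℂ) ^ (-w / 2))
      ((Real.pi : ℂ) ^ (-s / 2) * Complex.log Real.pi * (-1 / 2)) s :=
    HasDerivAt.const_cpow ((hasDerivAt_id s).neg.div_const 2) (Or.inl hpi)
  have d3 : HasDerivAt (fun w : ℂ => Complex.Gamma (w / 2)) (deriv Complex.Gamma (s / 2) * (1 / 2)) s := by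
    refine HasDerivAt.comp (h₂ := Complex.Gamma) s ?_ ((hasDerivAt_id s).div_const 2)
    refine (Complex.differentiableAt_Gamma _ fun m h => ?_).hasDerivAt
    have h' : s / 2 = -(m:ℂ) := h
    rw [h'] at hs2; simp at hs2
    linarith [(Nat.cast_nonneg m : (0:ℝ) ≤ m)]
  have d4 : HasDerivAt riemannZeta (deriv riemannZeta s) s := (differentiableAt_riemannZeta hs1).hasDerivAt
  have hd := (d1.mul ((d2.mul d3).mul d4)).congr_of_eventuallyEq he
  have hg := gm_logDeriv hs2
  rw [logDeriv_apply] at hg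
  have hg' : deriv Complex.Gamma (s / 2) = Complex.Gamma (s / 2) *
      (-(Real.eulerMascheroniConstant : ℂ) - 1 / (s / 2) + psSer (s / 2)) := by
    rw [← hg]; field_simp
  have hzs : z - 1 / 2 = s - 1 := by rw [hs]; ring
  rw [xG, ← hs, logDeriv_apply, hd.deriv, he.eq_of_nhds, hg', xA, ← hs, hzs, logDeriv_apply,
    Complex.ofReal_log Real.pi_pos.le]
  simp only [Pi.mul_apply]
  field_simp
  ring

lemma zeta_logDeriv {s : ℂ} (hs : 1 < s.re) :
    logDeriv riemannZeta s = -LSeries (fun n => (ArithmeticFunction.vonMangoldt n : ℂ)) s := by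
  rw [ArithmeticFunction.LSeries_vonMangoldt_eq_deriv_riemannZeta_div hs, logDeriv_apply]
  ring

lemma zeta_logDeriv_bound {σ : ℝ} (hσ : 1 < σ) : ∃ C : ℝ, 0 ≤ C ∧ ∀ s : ℂ, σ ≤ s.re → ‖logDeriv riemannZeta s‖ ≤ C := by
  have hsm := (ArithmeticFunction.LSeriesSummable_vonMangoldt (s := σ) (by simpa using hσ)).norm
  refine ⟨∑' n, ‖LSeries.term (fun n => (ArithmeticFunction.vonMangoldt n : ℂ)) σ n‖,
    tsum_nonneg fun n => norm_nonneg _, fun s hs => ?_⟩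
  rw [zeta_logDeriv (by linarith), norm_neg]
  refine tsum_of_norm_bounded hsm.hasSum fun n => ?_
  exact LSeries.norm_term_le_of_re_le_re _ (by simpa using hs) n

lemma xG_bound_far : ∃ C : ℝ, 0 ≤ C ∧ ∀ z : ℂ, 3 / 2 ≤ z.re → ‖xG z‖ ≤ C * (1 + ‖z‖) ^ (1 / 2 : ℝ) := by
  obtain ⟨C1, hC1, h1⟩ := xA_bound
  obtain ⟨C2, hC2, h2⟩ := zeta_logDeriv_bound (σ := 2) (by norm_num)
  refine ⟨C1 + 1 + C2, by positivity, fun z hz => ?_⟩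
  have hY : 1 ≤ (1 + ‖z‖) ^ (1 / 2 : ℝ) := Real.one_le_rpow (by linarith [norm_nonneg z]) (by norm_num)
  rw [xG_eq (by linarith)]
  have a1 := h1 z (by linarith)
  have a2 := h2 (z + 1 / 2) (by simp; linarith)
  have a3 : ‖1 / (z - 1 / 2)‖ ≤ 1 := by
    rw [norm_div, norm_one]
    have := Complex.re_le_norm (z - 1 / 2)
    have e : (z - 1 / 2).re = z.re - 1 / 2 := by simp
    rw [e] at this
    rw [div_le_one (by linarith)]
    linarith
  calc _ ≤ ‖xA z‖ + ‖1 / (z - 1 / 2)‖ + ‖logDeriv riemannZeta (z + 1 / 2)‖ := norm_add₃_le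
    _ ≤ _ := by nlinarith

lemma xG_bound (RH : RiemannHypothesis) {ε : ℝ} (hε : 0 < ε) : ∃ C : ℝ, 0 ≤ C ∧
    ∀ z : ℂ, ε ≤ z.re → ‖xG z‖ ≤ C * (1 + ‖z‖) ^ (1 / 2 : ℝ) := by
  obtain ⟨C1, hC1, h1⟩ := xG_bound_far
  refine ⟨C1 + 3 / ε + 3 / ε * (C1 * 4), by positivity, fun z hz => ?_⟩
  have hn := norm_nonneg z
  have hY : 1 ≤ (1 + ‖z‖) ^ (1 / 2 : ℝ) := Real.one_le_rpow (by linarith [norm_nonneg z]) (by norm_num)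
  set Y := (1 + ‖z‖) ^ (1 / 2 : ℝ) with hYd
  have p1 : 0 ≤ 3 / ε * Y := by positivity
  have p2 : 0 ≤ 3 / ε * (C1 * 4) * Y := by positivity
  rcases le_total (3 / 2) z.re with h | h
  · have := h1 z h
    nlinarith
  · set c : ℂ := 3 / 2 + z.im * I with hc
    have hcr : c.re = 3 / 2 := by simp [hc]
    have hzc : z - c = ((z.re - 3 / 2 : ℝ) : ℂ) := by
      apply Complex.ext <;> simp [hc]
    have hw : ‖z - c‖ = 3 / 2 - z.re := by
      rw [hzc, Complex.norm_real, Real.norm_eq_abs, abs_of_nonpos (by linarith)]; ring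
    have hball : ∀ w ∈ Metric.ball (0:ℂ) (3 / 2), 0 < (c + w).re := by
      intro w hw
      have hw' : ‖w‖ < 3 / 2 := by simpa using hw
      have := (abs_le.mp (Complex.abs_re_le_norm w)).1
      rw [Complex.add_re, hcr]; linarith
    have hbc := Complex.borelCaratheodory (f := fun w => -xG (c + w)) (R := 3 / 2) (z := z - c) one_pos
      (fun w hw => by
        apply DifferentiableAt.differentiableWithinAt
        exact ((xG_diff RH (hball w hw)).comp w (by fun_prop)).neg)
      (fun w hw => by
        simp only [Set.mem_ofPred_eq, neg_re]
        linarith [xG_re RH (hball w hw)]) (by norm_num) (by simp [hw]; linarith)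
    simp only [add_sub_cancel, norm_neg, add_zero, hw] at hbc
    have hcn : ‖c‖ ≤ ‖z‖ + 3 / 2 := by
      have := norm_sub_norm_le c z
      rw [norm_sub_rev] at this
      linarith
    have hGc : ‖xG c‖ ≤ C1 * (4 * Y) := by
      refine (h1 c hcr.ge).trans ?_
      gcongr
      rw [hYd, show (4:ℝ) = 16 ^ (1 / 2 : ℝ) by
        rw [show (16:ℝ) = 4 ^ (2:ℝ) by norm_num, ← Real.rpow_mul (by norm_num)]; norm_num,
        ← Real.mul_rpow (by norm_num) (by positivity)]
      gcongr
      linarith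
    have hden : ε ≤ 3 / 2 - (3 / 2 - z.re) := by linarith
    have b1 : 2 * 1 * (3 / 2 - z.re) / (3 / 2 - (3 / 2 - z.re)) ≤ 3 / ε :=
      div_le_div₀ (by norm_num) (by linarith) hε hden
    have b2 : ‖xG c‖ * (3 / 2 + (3 / 2 - z.re)) / (3 / 2 - (3 / 2 - z.re)) ≤ (C1 * (4 * Y)) * 3 / ε :=
      div_le_div₀ (by positivity) (mul_le_mul hGc (by linarith) (by linarith) (by positivity)) hε hden
    have b3 : (C1 * (4 * Y)) * 3 / ε = 3 / ε * (C1 * 4) * Y := by ring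
    have b4 : 3 / ε ≤ 3 / ε * Y := le_mul_of_one_le_right (by positivity) hY
    nlinarith

noncomputable def kK (w a : ℝ) (z : ℂ) : ℂ := Complex.exp (w * z) / (z - a) ^ 2

lemma kK_inv {z : ℂ} {a d : ℝ} (hd : 0 < d) (h : d ≤ ‖z - a‖) :
    1 / ‖z - a‖ ≤ ((1 + |a|) / d + 1) * (1 + ‖z‖)⁻¹ := by
  have h0 : 0 < ‖z - a‖ := hd.trans_le h
  have h1 : 1 + ‖z‖ ≤ ((1 + |a|) / d + 1) * ‖z - a‖ := by
    have e1 : ‖z‖ ≤ ‖z - a‖ + |a| := by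
      have := norm_add_le (z - a) (a : ℂ)
      simpa using this
    have e2 : 1 + |a| ≤ (1 + |a|) / d * ‖z - a‖ := by
      rw [div_mul_eq_mul_div, le_div_iff₀ hd]
      gcongr
    linarith
  have hz : 0 < 1 + ‖z‖ := by positivity
  rw [div_le_iff₀ h0, mul_assoc, mul_comm _ ‖z - a‖, ← mul_assoc, ← div_eq_mul_inv, le_div_iff₀ hz]
  linarith

noncomputable def kD (a α : ℝ) : ℝ := (1 + |a|) / |a - α| + 1

lemma kD_nonneg (a α : ℝ) : 0 ≤ kD a α := by unfold kD; positivity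

lemma kK_dist {z : ℂ} {a α : ℝ} (h : z.re ≤ α) (hα : α < a) : |a - α| ≤ ‖z - a‖ := by
  rw [abs_of_pos (by linarith)]
  have := (abs_le.mp (Complex.abs_re_le_norm (z - a))).1
  simp at this
  linarith

lemma kK_norm (w a : ℝ) (z : ℂ) : ‖kK w a z‖ = Real.exp (w * z.re) * (1 / ‖z - a‖) ^ 2 := by
  rw [kK, norm_div, Complex.norm_exp, norm_pow]
  simp [div_eq_mul_inv]

lemma kK_bound {w a α : ℝ} {z : ℂ} (h : z.re ≤ α) (hα : α < a) :
    ‖kK w a z‖ ≤ Real.exp (w * z.re) * (kD a α) ^ 2 * (1 + ‖z‖) ^ (-2 : ℝ) := by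
  have h1 := kK_inv (z := z) (a := a) (abs_pos.mpr (by linarith : a - α ≠ 0)) (kK_dist h hα)
  rw [kK_norm, mul_assoc]
  gcongr
  have : (1 + ‖z‖) ^ (-2 : ℝ) = ((1 + ‖z‖)⁻¹) ^ 2 := by
    rw [Real.rpow_neg (by positivity)]
    norm_num
  rw [this, ← mul_pow]
  exact pow_le_pow_left₀ (by positivity) h1 2

lemma kK_bound' {w a α : ℝ} (hw : 0 ≤ w) {z : ℂ} (h : z.re ≤ α) (hα : α < a) :
    ‖kK w a z‖ ≤ Real.exp (w * α) * (kD a α) ^ 2 * (1 + ‖z‖) ^ (-2 : ℝ) := by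
  refine (kK_bound h hα).trans ?_
  gcongr

lemma kK_diff {w a : ℝ} {z : ℂ} (h : z.re < a) : DifferentiableAt ℂ (kK w a) z := by
  unfold kK
  have : (z - a) ^ 2 ≠ 0 := by
    apply pow_ne_zero
    intro h'
    rw [sub_eq_zero] at h'
    rw [h'] at h; simp at h
  fun_prop (disch := assumption)

lemma rpow_merge {y : ℝ} (hy : 1 ≤ y) {e f : ℝ} (h : e ≤ f) : y ^ e ≤ y ^ f :=
  Real.rpow_le_rpow_of_exponent_le hy h

lemma one_le_n (z : ℂ) : 1 ≤ 1 + ‖z‖ := by linarith [norm_nonneg z]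

/-- product bound -/
lemma gk_bound {w a α C : ℝ} {g : ℂ → ℂ} {z : ℂ} (hw : 0 ≤ w) (h : z.re ≤ α) (hα : α < a)
    (hg : ‖g z‖ ≤ C * (1 + ‖z‖) ^ (1 / 2 : ℝ)) :
    ‖g z * kK w a z‖ ≤ C * (Real.exp (w * α) * (kD a α) ^ 2) * (1 + ‖z‖) ^ (-(3 / 2) : ℝ) := by
  rw [norm_mul]
  have hp : 0 < 1 + ‖z‖ := by positivity
  calc ‖g z‖ * ‖kK w a z‖ ≤ (C * (1 + ‖z‖) ^ (1 / 2 : ℝ)) *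
        (Real.exp (w * α) * (kD a α) ^ 2 * (1 + ‖z‖) ^ (-2 : ℝ)) :=
        mul_le_mul hg (kK_bound' hw h hα) (norm_nonneg _) ((norm_nonneg _).trans hg)
    _ = C * (Real.exp (w * α) * (kD a α) ^ 2) * ((1 + ‖z‖) ^ (1 / 2 : ℝ) * (1 + ‖z‖) ^ (-2 : ℝ)) := by ring
    _ = _ := by rw [← Real.rpow_add hp]; norm_num

lemma kK_integrable {w a α : ℝ} (hα : α < a) : Integrable (fun t : ℝ => kK w a (α + t * I)) := by
  apply cz_integrable_line (C := Real.exp (w * α) * (kD a α) ^ 2)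
  · intro z hz
    exact (kK_diff (by rw [hz]; exact hα)).continuousAt
  · intro z hz
    refine (kK_bound hz.le hα).trans ?_
    rw [hz]
    gcongr ?_ * ?_
    exact rpow_merge (one_le_n z) (by norm_num)

lemma kK_zero {w a α : ℝ} (hw : 0 ≤ w) (hα : α < a) : ∫ t : ℝ, kK w a (α + t * I) = 0 := by
  refine cz_vanish_left (C := Real.exp (w * α) * (kD a α) ^ 2) (R := 0)
    (fun z hz => kK_diff (hz.trans_lt hα)) fun z hz _ => ?_
  refine (kK_bound' hw hz hα).trans ?_
  gcongr ?_ * ?_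
  exact rpow_merge (one_le_n z) (by norm_num)

lemma kK_res {w a α p : ℝ} (hw : 0 ≤ w) (hα : α < a) (hp : p < α) :
    ∫ t : ℝ, 1 / ((α + t * I : ℂ) - p) * kK w a (α + t * I) = ((2 * Real.pi : ℝ) : ℂ) * kK w a p := by
  have h := cz_poisson_left (N := fun z => kK w a z * (2 * α - p - z)) (α := α) (p := p)
    (C := Real.exp (w * α) * (kD a α) ^ 2 * (1 + |2 * α - p|)) (R := 0) hp
    (fun z hz => (kK_diff (hz.trans_lt hα)).mul (by fun_prop)) (fun z hz _ => by
      have hz1 := one_le_n z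
      have hp : 0 < 1 + ‖z‖ := by positivity
      have e1 : ‖2 * (α:ℂ) - p - z‖ ≤ (1 + |2 * α - p|) * (1 + ‖z‖) := by
        have e2 : (2 * (α:ℂ) - p) = ((2 * α - p : ℝ) : ℂ) := by push_cast; ring
        have := norm_sub_le (2 * (α:ℂ) - p) z
        rw [e2, Complex.norm_real, Real.norm_eq_abs] at this
        rw [e2]
        nlinarith [abs_nonneg (2 * α - p), norm_nonneg z]
      rw [norm_mul]
      refine (mul_le_mul (kK_bound' hw hz hα) e1 (norm_nonneg _) (by positivity)).trans ?_
      have e3 : (1 + ‖z‖) ^ (-2 : ℝ) * (1 + ‖z‖) ≤ (1 + ‖z‖) ^ (1 / 2 : ℝ) := by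
        rw [← Real.rpow_add_one hp.ne']
        exact rpow_merge hz1 (by norm_num)
      calc _ = Real.exp (w * α) * (kD a α) ^ 2 * (1 + |2 * α - p|) * ((1 + ‖z‖) ^ (-2 : ℝ) * (1 + ‖z‖)) := by ring
        _ ≤ _ := by gcongr)
  have hap : ((α - p : ℝ) : ℂ) ≠ 0 := by exact_mod_cast (by linarith : α - p ≠ 0)
  have e : ((Real.pi / (α - p) : ℝ) : ℂ) * (kK w a p * (2 * α - p - p)) = ((2 * Real.pi : ℝ) : ℂ) * kK w a p := by
    push_cast at hap ⊢
    field_simp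
    ring
  rw [← e, ← h]
  congr 1
  ext t
  have e4 : ((α - p : ℝ) : ℂ) ^ 2 + (t : ℂ) ^ 2 = ((α + t * I : ℂ) - p) * (2 * α - p - (α + t * I)) := by
    push_cast
    ring_nf
    rw [I_sq]; ring
  have n1 : ((α + t * I : ℂ) - p) ≠ 0 := by
    intro h; have := congrArg Complex.re h; simp at this; linarith
  have n2 : (2 * α - p - (α + t * I : ℂ)) ≠ 0 := by
    intro h; have := congrArg Complex.re h; simp at this; linarith
  rw [e4]
  generalize (2 * α - p - (α + t * I : ℂ)) = q at n2
  field_simp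

lemma kK_neg {w a α : ℝ} (hw : w ≤ 0) (hα : α < a) :
    ∫ t : ℝ, kK w a (α + t * I) = ((2 * Real.pi * (-w) * Real.exp (w * a) : ℝ) : ℂ) := by
  have hE : Differentiable ℂ (fun z : ℂ => Complex.exp (w * z)) := by fun_prop
  have hds : Differentiable ℂ (dslope (fun z : ℂ => Complex.exp (w * z)) a) := by
    rw [← differentiableOn_univ, Complex.differentiableOn_dslope univ_mem, differentiableOn_univ]
    exact hE
  have h := cz_poisson_right (N := fun z => dslope (fun z : ℂ => Complex.exp (w * z)) a z * (2 * α - a - z))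
    (α := α) (p := a) (C := (Real.exp (w * α) + Real.exp (w * a)) * 4 * (1 + |2 * α - a|)) (R := 2 * ‖(a:ℂ)‖ + 1) hα
    (fun z hz => (hds z).mul (by fun_prop)) (fun z hz hR => by
      have hl := cz_lower hR
      have hz1 := one_le_n z
      have hne : z ≠ a := by
        rintro rfl
        simp at hl
        linarith [abs_nonneg a]
      have hY : 1 ≤ (1 + ‖z‖) ^ (1 / 2 : ℝ) := Real.one_le_rpow hz1 (by norm_num)
      have e1 : ‖2 * (α:ℂ) - a - z‖ ≤ (1 + |2 * α - a|) * (1 + ‖z‖) := by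
        have e2 : (2 * (α:ℂ) - a) = ((2 * α - a : ℝ) : ℂ) := by push_cast; ring
        have := norm_sub_le (2 * (α:ℂ) - a) z
        rw [e2, Complex.norm_real, Real.norm_eq_abs] at this
        rw [e2]
        nlinarith [abs_nonneg (2 * α - a), norm_nonneg z]
      rw [norm_mul, dslope_of_ne _ hne, slope_def_field, norm_div]
      have e3 : ‖Complex.exp (w * z) - Complex.exp (w * a)‖ ≤ Real.exp (w * α) + Real.exp (w * a) := by
        refine (norm_sub_le _ _).trans ?_
        rw [Complex.norm_exp, Complex.norm_exp]
        gcongr ?_ + ?_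
        · apply Real.exp_le_exp.mpr
          simp; nlinarith
        · simp
      have e4 : ‖Complex.exp (w * z) - Complex.exp (w * a)‖ / ‖z - a‖ ≤
          (Real.exp (w * α) + Real.exp (w * a)) / ((1 + ‖z‖) / 4) :=
        div_le_div₀ (by positivity) e3 (by positivity) hl
      calc _ ≤ (Real.exp (w * α) + Real.exp (w * a)) / ((1 + ‖z‖) / 4) * ((1 + |2 * α - a|) * (1 + ‖z‖)) := by
            gcongr
        _ = (Real.exp (w * α) + Real.exp (w * a)) * 4 * (1 + |2 * α - a|) * 1 := by
            field_simp
        _ ≤ _ := by gcongr)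
  have hda : dslope (fun z : ℂ => Complex.exp (w * z)) a a = Complex.exp (w * a) * w := by
    rw [dslope_same]
    have : HasDerivAt (fun z : ℂ => Complex.exp (w * z)) (Complex.exp (w * a) * w) a := by
      have := ((hasDerivAt_id (a:ℂ)).const_mul (w:ℂ)).cexp
      simpa using this
    exact this.deriv
  have hap : ((a - α : ℝ) : ℂ) ≠ 0 := by exact_mod_cast (by linarith : a - α ≠ 0)
  rw [hda] at h
  have e : ((Real.pi / (a - α) : ℝ) : ℂ) * (Complex.exp (w * a) * w * (2 * α - a - a)) =
      ((2 * Real.pi * (-w) * Real.exp (w * a) : ℝ) : ℂ) := by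
    push_cast at hap ⊢
    field_simp
    ring
  rw [e] at h
  rw [← h]
  have hz := kK_zero (w := 0) (a := a) (α := α) le_rfl hα
  have hi0 := kK_integrable (w := 0) (a := a) (α := α) hα
  have hiw := kK_integrable (w := w) (a := a) (α := α) hα
  have : ∫ t : ℝ, kK w a (α + t * I) = ∫ t : ℝ, (kK w a (α + t * I) - Complex.exp (w * a) * kK 0 a (α + t * I)) := by
    rw [integral_sub hiw (hi0.const_mul _), integral_const_mul, hz]; simp
  rw [this]
  congr 1
  ext t
  have n1 : ((α + t * I : ℂ) - a) ≠ 0 := by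
    intro h; have := congrArg Complex.re h; simp at this; linarith
  have n2 : (2 * α - a - (α + t * I : ℂ)) ≠ 0 := by
    intro h; have := congrArg Complex.re h; simp at this; linarith
  have e4 : ((a - α : ℝ) : ℂ) ^ 2 + (t : ℂ) ^ 2 = ((α + t * I : ℂ) - a) * (2 * α - a - (α + t * I)) := by
    push_cast
    ring_nf
    rw [I_sq]; ring
  rw [e4, dslope_of_ne _ (sub_ne_zero.mp n1), slope_def_field, kK, kK]
  simp only [ofReal_zero, zero_mul, Complex.exp_zero]
  generalize (2 * α - a - (α + t * I : ℂ)) = q at n2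
  field_simp

lemma kK_all {w a α : ℝ} (hα : α < a) :
    ∫ t : ℝ, kK w a (α + t * I) = ((2 * Real.pi * max (-w) 0 * Real.exp (w * a) : ℝ) : ℂ) := by
  rcases le_total 0 w with h | h
  · rw [kK_zero h hα, max_eq_right (by linarith)]; simp
  · rw [kK_neg h hα, max_eq_left (by linarith)]

/-- The terms of the tail sum. -/
noncomputable def tl (u s : ℝ) (n : ℕ) : ℝ :=
  ArithmeticFunction.vonMangoldt n * Real.exp (-s * Real.log n) * max (Real.log n - u) 0

lemma J_zeta {u a α : ℝ} (h1 : 1 / 2 < α) (h2 : α < a) :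
    HasSum (fun n => ((2 * Real.pi * Real.exp (u * a) * tl u (a + 1 / 2) n : ℝ) : ℂ))
      (-∫ t : ℝ, logDeriv riemannZeta ((α + t * I) + 1 / 2) * kK u a (α + t * I)) := by
  set L : ℕ → ℂ := fun n => (ArithmeticFunction.vonMangoldt n : ℂ) with hL
  set F : ℕ → ℝ → ℂ := fun n t => LSeries.term L ((α + t * I) + 1 / 2) n * kK u a (α + t * I) with hF
  have hform : ∀ n t, F n t = ((ArithmeticFunction.vonMangoldt n * Real.exp (-(1 / 2) * Real.log n) : ℝ) : ℂ) *
      kK (u - Real.log n) a (α + t * I) := by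
    intro n t
    rcases eq_or_ne n 0 with rfl | hn
    · simp [hF]
    · simp only [hF, LSeries.term_of_ne_zero hn, kK, hL]
      rw [Complex.cpow_def_of_ne_zero (by exact_mod_cast hn), Complex.natCast_log.symm,
        div_eq_mul_inv (_ : ℂ) (Complex.exp _), ← Complex.exp_neg]
      push_cast
      rw [mul_assoc, mul_assoc, ← mul_div_assoc, ← Complex.exp_add,
        show -(log (n:ℂ) * (α + t * I + 1 / 2)) + u * (α + t * I) =
          -(1 / 2) * log (n:ℂ) + (u - log (n:ℂ)) * (α + t * I) by ring, Complex.exp_add]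
      ring
  have hint : ∀ n, Integrable (F n) := by
    intro n
    have : F n = fun t => _ := funext (hform n)
    rw [this]
    exact (kK_integrable h2).const_mul _
  have hval : ∀ n, ∫ t, F n t = ((2 * Real.pi * Real.exp (u * a) * tl u (a + 1 / 2) n : ℝ) : ℂ) := by
    intro n
    rw [integral_congr_ae (Eventually.of_forall (hform n)), integral_const_mul, kK_all h2, ← ofReal_mul]
    congr 1
    rw [tl, show -(u - Real.log n) = Real.log n - u by ring,
      show (u - Real.log n) * a = u * a + -(a * Real.log n) by ring,
      show -(a + 1 / 2) * Real.log n = -(1 / 2) * Real.log n + -(a * Real.log n) by ring,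
      Real.exp_add, Real.exp_add]
    ring
  have hsum : Summable fun n => ∫ t, ‖F n t‖ := by
    have hs := (ArithmeticFunction.LSeriesSummable_vonMangoldt (s := ((α + 1 / 2 : ℝ) : ℂ))
      (by rw [ofReal_re]; linarith)).norm
    refine (hs.mul_right (∫ t : ℝ, ‖kK u a (α + t * I)‖)).congr fun n => ?_
    rw [← integral_const_mul]
    congr 1
    ext t
    simp only [hF]
    rw [norm_mul]
    congr 1
    rw [LSeries.norm_term_eq, LSeries.norm_term_eq]
    simp [hL]
  have := hasSum_integral_of_summable_integral_norm hint hsum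
  simp only [hval] at this
  have e : (-∫ t : ℝ, logDeriv riemannZeta ((α + t * I) + 1 / 2) * kK u a (α + t * I)) =
      ∫ t, ∑' n, F n t := by
    rw [← integral_neg]
    congr 1
    ext t
    simp only [hF]
    rw [tsum_mul_right, zeta_logDeriv (by simp; linarith), LSeries]
    ring
  rw [e]
  exact this

lemma J_A {u a ε : ℝ} (hu : 0 ≤ u) (h1 : 0 < ε) (h2 : ε < a) :
    (∫ t : ℝ, xA (ε + t * I) * kK u a (ε + t * I)).re ≤ 0 := by
  have hi := kK_integrable (w := u) h2
  have hz := kK_zero hu h2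
  set c : ℂ := -((Real.log Real.pi : ℝ) : ℂ) / 2 - (Real.eulerMascheroniConstant : ℂ) / 2 with hc
  set F : ℕ → ℝ → ℂ := fun n t => psTerm n (((ε + t * I) + 1 / 2) / 2) / 2 * kK u a (ε + t * I) with hF
  have hline : ∀ t : ℝ, ((ε + t * I : ℂ)).re = ε := fun t => by simp
  have hsr : ∀ t : ℝ, 0 ≤ ((((ε + t * I : ℂ)) + 1 / 2) / 2).re := fun t => by simp; linarith
  have hform : ∀ n t, F n t = (1 / (2 * ((n:ℂ) + 1))) * kK u a (ε + t * I) -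
      1 / ((ε + t * I : ℂ) - ((-(2 * n + 5 / 2) : ℝ) : ℂ)) * kK u a (ε + t * I) := by
    intro n t
    have hn0 : ((n:ℂ) + 1) ≠ 0 := by exact_mod_cast Nat.succ_ne_zero n
    simp only [hF, psTerm]
    rw [← sub_mul]
    congr 1
    have e : ((ε + t * I : ℂ) - ((-(2 * n + 5 / 2) : ℝ) : ℂ)) = 2 * (((ε + t * I) + 1 / 2) / 2 + ((n:ℂ) + 1)) := by
      push_cast; ring
    have hne : (((ε + t * I : ℂ) + 1 / 2) / 2 + ((n:ℂ) + 1)) ≠ 0 := by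
      intro h
      have := congrArg Complex.re h
      simp at this
      have : (0:ℝ) ≤ n := n.cast_nonneg
      linarith
    rw [e]
    generalize (((ε + t * I : ℂ) + 1 / 2) / 2 + ((n:ℂ) + 1)) = q at hne
    field_simp
  have hbd : ∀ n t, ‖F n t‖ ≤ ((n:ℝ) + 1) ^ (-(3 / 2) : ℝ) *
      (Real.exp (u * ε) * (kD a ε) ^ 2 * (1 + ‖t‖) ^ (-(3 / 2) : ℝ)) := by
    intro n t
    have b1 := ps_bound2 (hsr t) n
    have b2 : ‖(((ε + t * I : ℂ)) + 1 / 2) / 2‖ ≤ 1 + ‖(ε + t * I : ℂ)‖ := by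
      rw [norm_div, Complex.norm_ofNat]
      have := norm_add_le (ε + t * I : ℂ) (1 / 2)
      have e : ‖(1 / 2 : ℂ)‖ = 1 / 2 := by norm_num
      rw [e] at this
      linarith [norm_nonneg (ε + t * I : ℂ)]
    have b3 : ‖(fun z : ℂ => psTerm n ((z + 1 / 2) / 2) / 2) (ε + t * I)‖ ≤
        ((n:ℝ) + 1) ^ (-(3 / 2) : ℝ) * (1 + ‖(ε + t * I : ℂ)‖) ^ (1 / 2 : ℝ) := by
      simp only []
      rw [norm_div, Complex.norm_ofNat]
      have b4 : ‖(((ε + t * I : ℂ)) + 1 / 2) / 2‖ ^ (1 / 2 : ℝ) ≤ (1 + ‖(ε + t * I : ℂ)‖) ^ (1 / 2 : ℝ) := by gcongr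
      have b5 : 0 ≤ ((n:ℝ) + 1) ^ (-(3 / 2) : ℝ) := by positivity
      nlinarith [norm_nonneg (psTerm n ((((ε + t * I : ℂ)) + 1 / 2) / 2)), mul_le_mul_of_nonneg_right b4 b5]
    have b6 := gk_bound (g := fun z : ℂ => psTerm n ((z + 1 / 2) / 2) / 2) hu (hline t).le h2 b3
    refine b6.trans ?_
    rw [mul_assoc]
    gcongr ?_ * (?_ * ?_)
    exact cz_weight_line ε t
  have hcontF : ∀ n, AEStronglyMeasurable (F n) volume := by
    intro n
    have : F n = fun t => _ := funext (hform n)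
    rw [this]
    refine (hi.const_mul _).aestronglyMeasurable.sub (AEStronglyMeasurable.mul ?_ hi.aestronglyMeasurable)
    refine Continuous.aestronglyMeasurable ?_
    refine continuous_const.div (by fun_prop) fun t h => ?_
    have := congrArg Complex.re h
    simp at this
    have : (0:ℝ) ≤ n := n.cast_nonneg
    linarith
  have hW := (cz_integrable_weight (3 / 2) (by norm_num)).const_mul (Real.exp (u * ε) * (kD a ε) ^ 2)
  have hint : ∀ n, Integrable (F n) := fun n =>
    Integrable.mono' (hW.const_mul (((n:ℝ) + 1) ^ (-(3 / 2) : ℝ))) (hcontF n) (Eventually.of_forall (hbd n))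
  have hsum : Summable fun n => ∫ t, ‖F n t‖ := by
    refine Summable.of_nonneg_of_le (fun n => integral_nonneg fun t => norm_nonneg _) (fun n => ?_)
      (gm_summable_32.mul_right (∫ t : ℝ, Real.exp (u * ε) * (kD a ε) ^ 2 * (1 + ‖t‖) ^ (-(3 / 2) : ℝ)))
    rw [← integral_const_mul]
    exact integral_mono (hint n).norm (hW.const_mul _) (hbd n)
  have hval : ∀ n, (∫ t, F n t).re ≤ 0 := by
    intro n
    have hn : (0:ℝ) ≤ n := n.cast_nonneg
    have hi2 : Integrable fun t : ℝ => (1 / (2 * ((n:ℂ) + 1))) * kK u a (ε + t * I) := hi.const_mul _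
    have hi3 : Integrable fun t : ℝ => 1 / ((ε + t * I : ℂ) - ((-(2 * n + 5 / 2) : ℝ) : ℂ)) * kK u a (ε + t * I) := by
      have := hi2.sub (hint n)
      refine this.congr (Eventually.of_forall fun t => ?_)
      simp only [Pi.sub_apply, hform]; ring
    rw [integral_congr_ae (Eventually.of_forall (hform n)), integral_sub hi2 hi3,
      integral_const_mul, hz, kK_res hu h2 (by linarith)]
    have e : kK u a ((-(2 * n + 5 / 2) : ℝ) : ℂ) =
        ((Real.exp (u * (-(2 * n + 5 / 2))) / ((-(2 * n + 5 / 2)) - a) ^ 2 : ℝ) : ℂ) := by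
      rw [kK]; push_cast; ring_nf
    rw [e, mul_zero, zero_sub, ← ofReal_mul, neg_re, ofReal_re]
    have := Real.pi_pos
    simp only [Left.neg_nonpos_iff]
    positivity
  have hS := hasSum_integral_of_summable_integral_norm hint hsum
  have hSr := Complex.hasSum_re hS
  have hle : (∫ t, ∑' n, F n t).re ≤ 0 := hSr.nonpos hval
  have hFS : ∀ t : ℝ, ∑' n, F n t = psSer (((ε + t * I) + 1 / 2) / 2) / 2 * kK u a (ε + t * I) := by
    intro t
    simp only [hF]
    rw [tsum_mul_right, tsum_div_const, psSer]
  have htot : ∫ t : ℝ, xA (ε + t * I) * kK u a (ε + t * I) = ∫ t, ∑' n, F n t := by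
    have e1 : ∀ t : ℝ, ∑' n, F n t = xA (ε + t * I) * kK u a (ε + t * I) - c * kK u a (ε + t * I) := by
      intro t; rw [hFS, xA]; ring
    obtain ⟨C, hC, hb⟩ := xA_bound
    have hiA : Integrable fun t : ℝ => xA (ε + t * I) * kK u a (ε + t * I) :=
      cz_integrable_line (g := fun z => xA z * kK u a z) (C := C * (Real.exp (u * ε) * (kD a ε) ^ 2))
        (fun z hz => ((xA_diff (by linarith)).mul (kK_diff (by linarith))).continuousAt)
        (fun z hz => gk_bound hu hz.le h2 (hb z (by linarith)))
    simp only [e1]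
    rw [integral_sub hiA (hi.const_mul c), integral_const_mul, hz]; simp
  rw [htot]; exact hle

lemma J_G (RH : RiemannHypothesis) {u a ε : ℝ} (hu : 0 ≤ u) (h1 : 0 < ε) (h2 : ε < 1 / 2) (ha : 1 / 2 < a) :
    ‖∫ t : ℝ, xG (ε + t * I) * kK u a (ε + t * I)‖ ≤
      2 * Real.pi * Real.exp (u * ε) * |Bconst| / (1 / 2 - ε) := by
  obtain ⟨C, hC, hb⟩ := xG_bound RH h1
  have h2a : ε < a := by linarith
  have hline : ∀ t : ℝ, ((ε + t * I : ℂ)).re = ε := fun t => by simp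
  have hiG : Integrable fun t : ℝ => xG (ε + t * I) * kK u a (ε + t * I) :=
    cz_integrable_line (g := fun z => xG z * kK u a z) (C := C * (Real.exp (u * ε) * (kD a ε) ^ 2))
      (fun z hz => ((xG_diff RH (by linarith)).mul (kK_diff (by linarith))).continuousAt)
      (fun z hz => gk_bound hu hz.le h2a (hb z (by linarith)))
  -- the reflected integrand
  have hbr : ∀ z : ℂ, z.re ≤ ε → ‖(fun z => xG (2 * ε - z)) z‖ ≤
      C * (1 + 2 * ε) ^ (1 / 2 : ℝ) * (1 + ‖z‖) ^ (1 / 2 : ℝ) := by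
    intro z hz
    have := hb (2 * ε - z) (by simp; linarith)
    refine this.trans ?_
    rw [mul_assoc, ← Real.mul_rpow (by positivity) (by positivity)]
    gcongr
    have e : ‖2 * (ε:ℂ) - z‖ ≤ 2 * ε + ‖z‖ := by
      refine (norm_sub_le _ _).trans ?_
      rw [norm_mul, Complex.norm_real, Complex.norm_ofNat, Real.norm_of_nonneg h1.le]
    nlinarith [norm_nonneg z]
  have hdr : ∀ z : ℂ, z.re ≤ ε → DifferentiableAt ℂ (fun z => xG (2 * ε - z) * kK u a z) z := by
    intro z hz
    have d1 : DifferentiableAt ℂ (fun z : ℂ => xG (2 * ε - z)) z :=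
      DifferentiableAt.comp (g := xG) (f := fun z : ℂ => 2 * (ε:ℂ) - z) z
        (xG_diff RH (by simp; linarith)) (by fun_prop)
    exact d1.mul (kK_diff (by linarith))
  have hv : ∫ t : ℝ, (fun z => xG (2 * ε - z) * kK u a z) (ε + t * I) = 0 :=
    cz_vanish_left (R := 0) hdr (fun z hz _ => gk_bound (g := fun z => xG (2 * ε - z)) hu hz h2a (hbr z hz))
  have hiR : Integrable fun t : ℝ => (fun z => xG (2 * ε - z) * kK u a z) (ε + t * I) :=
    cz_integrable_line (fun z hz => (hdr z hz.le).continuousAt)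
      (fun z hz => gk_bound (g := fun z => xG (2 * ε - z)) hu hz.le h2a (hbr z hz.le))
  have hsplit : ∫ t : ℝ, xG (ε + t * I) * kK u a (ε + t * I) =
      ∫ t : ℝ, ((2 * (xG (ε + t * I)).re : ℝ) : ℂ) * kK u a (ε + t * I) := by
    have : ∫ t : ℝ, xG (ε + t * I) * kK u a (ε + t * I) =
        ∫ t : ℝ, (xG (ε + t * I) * kK u a (ε + t * I) + (fun z => xG (2 * ε - z) * kK u a z) (ε + t * I)) := by
      rw [integral_add hiG hiR, hv, add_zero]
    rw [this]
    congr 1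
    ext t
    have e : 2 * (ε:ℂ) - (ε + t * I) = (starRingEnd ℂ) (ε + t * I) := by
      apply Complex.ext <;> simp
      ring
    simp only []
    rw [e, xG_conj, ← add_mul, Complex.add_conj]
  have hp := cz_poisson_right (N := xG) (α := ε) (p := 1 / 2) (C := C) (R := 0) h2
    (fun z hz => xG_diff RH (by linarith)) (fun z hz _ => hb z hz)
  have hpI : Integrable fun t : ℝ => xG (ε + t * I) / (((1 / 2 - ε : ℝ) : ℂ) ^ 2 + (t : ℂ) ^ 2) := by
    have := cz_integrable_line (g := fun z => (xG z) * kK 0 (1/2) z) (c := ε)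
      (C := C * (Real.exp (0 * ε) * (kD (1/2) ε) ^ 2))
      (fun z hz => ((xG_diff RH (by linarith)).mul (kK_diff (by linarith))).continuousAt)
      (fun z hz => gk_bound le_rfl hz.le h2 (hb z (by linarith)))
    refine Integrable.mono this ?_ (Eventually.of_forall fun t => ?_)
    · apply Continuous.aestronglyMeasurable
      have hc : Continuous fun t : ℝ => xG (ε + t * I) := by
        rw [continuous_iff_continuousAt]
        intro t
        exact ContinuousAt.comp (f := fun t : ℝ => (ε + t * I : ℂ))
          (xG_diff RH (by rw [hline]; exact h1)).continuousAt (by fun_prop)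
      refine hc.div (by fun_prop) fun t h => ?_
      have : ((1 / 2 - ε : ℝ) : ℂ) ^ 2 + (t : ℂ) ^ 2 = (((1 / 2 - ε) ^ 2 + t ^ 2 : ℝ) : ℂ) := by push_cast; ring
      rw [this] at h
      have h' : (1 / 2 - ε) ^ 2 + t ^ 2 = 0 := by exact_mod_cast h
      nlinarith [sq_nonneg t, pow_pos (by linarith : 0 < 1 / 2 - ε) 2]
    · rw [norm_div, norm_mul, kK_norm]
      have e1 : ((1 / 2 - ε : ℝ) : ℂ) ^ 2 + (t : ℂ) ^ 2 = (((1 / 2 - ε) ^ 2 + t ^ 2 : ℝ) : ℂ) := by push_cast; ring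
      have e2 : ‖(ε + t * I : ℂ) - ((1 / 2 : ℝ) : ℂ)‖ ^ 2 = (1 / 2 - ε) ^ 2 + t ^ 2 := by
        rw [← Complex.normSq_eq_norm_sq, Complex.normSq_apply]
        simp; ring
      rw [e1, Complex.norm_real, Real.norm_of_nonneg (by positivity), div_pow, e2]
      simp [div_eq_mul_inv]
  have hpr : ∫ t : ℝ, (xG (ε + t * I)).re / ((1 / 2 - ε) ^ 2 + t ^ 2) = Real.pi / (1 / 2 - ε) * |Bconst| := by
    have h3 := congrArg Complex.re hp
    have e3 : ((1 / 2 : ℝ) : ℂ) = 1 / 2 := by push_cast; ring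
    rw [e3, xG_half RH, ← ofReal_mul, ofReal_re] at h3
    rw [← h3]
    have := integral_re hpI
    simp only [RCLike.re_eq_complex_re] at this
    rw [← this]
    congr 1
    ext t
    have e1 : ((1 / 2 - ε : ℝ) : ℂ) ^ 2 + (t : ℂ) ^ 2 = (((1 / 2 - ε) ^ 2 + t ^ 2 : ℝ) : ℂ) := by push_cast; ring
    rw [e1, Complex.div_ofReal_re]
  have hprI : Integrable fun t : ℝ => (xG (ε + t * I)).re / ((1 / 2 - ε) ^ 2 + t ^ 2) := by
    have := hpI.re
    refine this.congr (Eventually.of_forall fun t => ?_)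
    have e1 : ((1 / 2 - ε : ℝ) : ℂ) ^ 2 + (t : ℂ) ^ 2 = (((1 / 2 - ε) ^ 2 + t ^ 2 : ℝ) : ℂ) := by push_cast; ring
    simp only [RCLike.re_eq_complex_re]
    rw [e1, Complex.div_ofReal_re]
  rw [hsplit]
  refine (norm_integral_le_of_norm_le (hprI.const_mul (2 * Real.exp (u * ε))) (Eventually.of_forall fun t => ?_)).trans ?_
  · have hre := xG_re RH (z := ε + t * I) (by rw [hline]; exact h1)
    rw [norm_mul, kK_norm, Complex.norm_real, Real.norm_of_nonneg (by positivity), hline]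
    have e2 : ‖(ε + t * I : ℂ) - (a : ℂ)‖ ^ 2 = (a - ε) ^ 2 + t ^ 2 := by
      rw [← Complex.normSq_eq_norm_sq, Complex.normSq_apply]
      simp; ring
    rw [div_pow, e2]
    have hpos : 0 < (1 / 2 - ε) ^ 2 + t ^ 2 := by
      have := pow_pos (by linarith : 0 < 1 / 2 - ε) 2; positivity
    have e3 : 1 ^ 2 / ((a - ε) ^ 2 + t ^ 2) ≤ 1 / ((1 / 2 - ε) ^ 2 + t ^ 2) := by
      rw [one_pow]
      apply one_div_le_one_div_of_le hpos
      nlinarith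
    calc _ ≤ 2 * (xG (ε + t * I)).re * (Real.exp (u * ε) * (1 / ((1 / 2 - ε) ^ 2 + t ^ 2))) := by gcongr
      _ = _ := by ring
  · rw [integral_const_mul, hpr]
    apply le_of_eq; ring

lemma tl_nonneg (u s : ℝ) (n : ℕ) : 0 ≤ tl u s n := by
  rw [tl]
  have := ArithmeticFunction.vonMangoldt_nonneg (n := n)
  positivity

/-- The difference of the two main functions. -/
noncomputable def xF (z : ℂ) : ℂ := xG z - xA z

set_option maxHeartbeats 400000 in
lemma tl_eps (RH : RiemannHypothesis) {u a ε : ℝ} (hu : 0 ≤ u) (h1 : 0 < ε) (h2 : ε < 1 / 2) (ha : 1 / 2 < a) :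
    Summable (tl u (a + 1 / 2)) ∧ 2 * Real.pi * Real.exp (u * a) * ∑' n, tl u (a + 1 / 2) n ≤
      2 * Real.pi * (Real.exp (u / 2) / (a - 1 / 2) ^ 2) +
        2 * Real.pi * Real.exp (u * ε) * |Bconst| / (1 / 2 - ε) := by
  obtain ⟨α, hα1, hα2⟩ := exists_between ha
  have hεα : ε < α := h2.trans hα1
  have hεa : ε < a := hεα.trans hα2
  obtain ⟨C, hC, hb⟩ := xG_bound RH h1
  obtain ⟨D, hD, hbA⟩ := xA_bound
  have hlε : ∀ t : ℝ, ((ε + t * I : ℂ)).re = ε := fun t => by simp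
  have hlα : ∀ t : ℝ, ((α + t * I : ℂ)).re = α := fun t => by simp
  have hbF : ∀ z : ℂ, ε ≤ z.re → ‖xF z‖ ≤ (C + D) * (1 + ‖z‖) ^ (1 / 2 : ℝ) := by
    intro z hz
    refine (norm_sub_le _ _).trans ?_
    rw [add_mul]
    exact add_le_add (hb z hz) (hbA z (by linarith))
  have hdF : ∀ z : ℂ, ε ≤ z.re → z.re ≤ α → DifferentiableAt ℂ (fun z => xF z * kK u a z) z := by
    intro z hz hz'
    exact ((xG_diff RH (by linarith)).sub (xA_diff (by linarith))).mul (kK_diff (by linarith))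
  have hshift := cz_strip_shift (g := fun z => xF z * kK u a z) hεα.le hdF
    (fun z hz hz' => gk_bound (g := xF) hu hz' hα2 (hbF z hz))
  have hiG : Integrable fun t : ℝ => xG (ε + t * I) * kK u a (ε + t * I) :=
    cz_integrable_line (g := fun z => xG z * kK u a z) (C := C * (Real.exp (u * ε) * (kD a ε) ^ 2))
      (fun z hz => ((xG_diff RH (by linarith)).mul (kK_diff (by linarith))).continuousAt)
      (fun z hz => gk_bound (g := xG) hu hz.le hεa (hb z (by linarith)))
  have hiA : Integrable fun t : ℝ => xA (ε + t * I) * kK u a (ε + t * I) :=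
    cz_integrable_line (g := fun z => xA z * kK u a z) (C := D * (Real.exp (u * ε) * (kD a ε) ^ 2))
      (fun z hz => ((xA_diff (by linarith)).mul (kK_diff (by linarith))).continuousAt)
      (fun z hz => gk_bound (g := xA) hu hz.le hεa (hbA z (by linarith)))
  have hiα : Integrable fun t : ℝ => (fun z => xF z * kK u a z) (α + t * I) :=
    cz_integrable_line (fun z hz => (hdF z (by linarith) hz.le).continuousAt)
      (fun z hz => gk_bound (g := xF) hu hz.le hα2 (hbF z (by linarith)))
  have hk := kK_integrable (w := u) hα2
  have hiP : Integrable fun t : ℝ => 1 / ((α + t * I : ℂ) - ((1 / 2 : ℝ) : ℂ)) * kK u a (α + t * I) := by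
    refine Integrable.bdd_mul (c := 1 / (α - 1 / 2)) hk ?_ (Eventually.of_forall fun t => ?_)
    · refine Continuous.aestronglyMeasurable ?_
      refine continuous_const.div (by fun_prop) fun t h => ?_
      have := congrArg Complex.re h
      simp at this
      linarith
    · rw [norm_div, norm_one]
      apply one_div_le_one_div_of_le (by linarith)
      refine le_trans ?_ (Complex.re_le_norm _)
      simp
  have hpt : ∀ t : ℝ, (fun z => xF z * kK u a z) (α + t * I) =
      1 / ((α + t * I : ℂ) - ((1 / 2 : ℝ) : ℂ)) * kK u a (α + t * I) +
        logDeriv riemannZeta ((α + t * I) + 1 / 2) * kK u a (α + t * I) := by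
    intro t
    simp only []
    rw [xF, xG_eq (by rw [hlα]; exact hα1)]
    push_cast
    ring
  have hiZ : Integrable fun t : ℝ => logDeriv riemannZeta ((α + t * I) + 1 / 2) * kK u a (α + t * I) := by
    refine (hiα.sub hiP).congr (Eventually.of_forall fun t => ?_)
    simp only [Pi.sub_apply]
    have := hpt t
    simp only [] at this
    rw [this]; ring
  have hZ := J_zeta (u := u) hα1 hα2
  have hsplitα : ∫ t : ℝ, (fun z => xF z * kK u a z) (α + t * I) =
      ((2 * Real.pi : ℝ) : ℂ) * kK u a ((1 / 2 : ℝ) : ℂ) +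
        ∫ t : ℝ, logDeriv riemannZeta ((α + t * I) + 1 / 2) * kK u a (α + t * I) := by
    rw [integral_congr_ae (Eventually.of_forall hpt), integral_add hiP hiZ, kK_res hu hα2 hα1]
  have hsplitε : ∫ t : ℝ, (fun z => xF z * kK u a z) (ε + t * I) =
      (∫ t : ℝ, xG (ε + t * I) * kK u a (ε + t * I)) - ∫ t : ℝ, xA (ε + t * I) * kK u a (ε + t * I) := by
    rw [← integral_sub hiG hiA]
    congr 1
    ext t
    simp only [xF]
    ring
  have hkh : kK u a ((1 / 2 : ℝ) : ℂ) = ((Real.exp (u / 2) / (a - 1 / 2) ^ 2 : ℝ) : ℂ) := by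
    rw [kK]; push_cast
    rw [show ((1:ℂ) / 2 - a) ^ 2 = (a - 1 / 2) ^ 2 by ring, mul_one_div]
  have hA := J_A (u := u) hu h1 hεa
  have hG := J_G RH (u := u) hu h1 h2 ha
  have hZr := Complex.hasSum_re hZ
  simp only [ofReal_re] at hZr
  have hpos : 0 < 2 * Real.pi * Real.exp (u * a) := by have := Real.pi_pos; positivity
  have hsm : Summable (tl u (a + 1 / 2)) := (summable_mul_left_iff hpos.ne').1 hZr.summable
  refine ⟨hsm, ?_⟩
  rw [← tsum_mul_left, hZr.tsum_eq]
  have hGre := (neg_le_abs _).trans ((Complex.abs_re_le_norm _).trans hG)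
  rw [hsplitε, hsplitα, hkh, ← ofReal_mul] at hshift
  have hre := congrArg Complex.re hshift
  rw [add_re, sub_re, ofReal_re] at hre
  rw [neg_re]
  linarith

lemma tl_le (RH : RiemannHypothesis) {u s : ℝ} (hu : 0 ≤ u) (hs : 1 < s) :
    Summable (tl u s) ∧ ∑' n, tl u s n ≤
      Real.exp (-(u * (s - 1))) / (s - 1) ^ 2 + 2 * |Bconst| * Real.exp (-(u * (s - 1 / 2))) := by
  have ha : 1 / 2 < s - 1 / 2 := by linarith
  have es : s - 1 / 2 + 1 / 2 = s := by ring
  have hS := (tl_eps RH hu (ε := 1 / 4) (by norm_num) (by norm_num) ha).1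
  rw [es] at hS
  refine ⟨hS, ?_⟩
  have hlim : Tendsto (fun ε : ℝ => 2 * Real.pi * (Real.exp (u / 2) / (s - 1 / 2 - 1 / 2) ^ 2) +
        2 * Real.pi * Real.exp (u * ε) * |Bconst| / (1 / 2 - ε)) (𝓝[>] 0)
      (𝓝 (2 * Real.pi * (Real.exp (u / 2) / (s - 1 / 2 - 1 / 2) ^ 2) +
        2 * Real.pi * Real.exp (u * 0) * |Bconst| / (1 / 2 - 0))) := by
    have : ContinuousAt (fun ε : ℝ => 2 * Real.pi * (Real.exp (u / 2) / (s - 1 / 2 - 1 / 2) ^ 2) +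
        2 * Real.pi * Real.exp (u * ε) * |Bconst| / (1 / 2 - ε)) 0 := by
      refine continuousAt_const.add (ContinuousAt.div (by fun_prop) (by fun_prop) (by norm_num))
    exact this.tendsto.mono_left nhdsWithin_le_nhds
  have hle := ge_of_tendsto hlim (b := 2 * Real.pi * Real.exp (u * (s - 1 / 2)) * ∑' n, tl u s n) (by
    filter_upwards [Ioo_mem_nhdsGT (show (0:ℝ) < 1 / 2 by norm_num)] with ε hε
    have := (tl_eps RH hu hε.1 hε.2 ha).2
    rwa [es] at this)
  have hp : 0 < 2 * Real.pi * Real.exp (u * (s - 1 / 2)) := by have := Real.pi_pos; positivity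
  rw [mul_zero, Real.exp_zero, sub_zero] at hle
  refine le_of_mul_le_mul_left (hle.trans (le_of_eq ?_)) hp
  have e1 : Real.exp (u * (s - 1 / 2)) * Real.exp (-(u * (s - 1))) = Real.exp (u / 2) := by
    rw [← Real.exp_add]; congr 1; ring
  have e2 : Real.exp (u * (s - 1 / 2)) * Real.exp (-(u * (s - 1 / 2))) = 1 := by
    rw [← Real.exp_add]; simp
  rw [show s - 1 / 2 - 1 / 2 = s - 1 by ring]
  linear_combination (-2 * Real.pi / (s - 1) ^ 2) * e1 - 4 * Real.pi * |Bconst| * e2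

lemma term_real (f : ℕ → ℝ) (h0 : f 0 = 0) (s : ℝ) (n : ℕ) :
    LSeries.term (fun n => (f n : ℂ)) s n = ((f n * Real.exp (-s * Real.log n) : ℝ) : ℂ) := by
  rcases eq_or_ne n 0 with rfl | hn
  · simp [h0]
  · rw [LSeries.term_of_ne_zero hn, Complex.cpow_def_of_ne_zero (by exact_mod_cast hn),
      Complex.natCast_log.symm, div_eq_mul_inv, ← Complex.exp_neg]
    push_cast
    congr 2
    ring

/-- The coefficients of the logarithm of zeta. -/
noncomputable def lz (n : ℕ) : ℝ := ArithmeticFunction.vonMangoldt n / Real.log n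

lemma lz_zero : lz 0 = 0 := by simp [lz]
lemma lz_one : lz 1 = 0 := by simp [lz]

lemma log_nat_nonneg (n : ℕ) : 0 ≤ Real.log n := Real.log_natCast_nonneg n

lemma lz_mul_log (n : ℕ) : lz n * Real.log n = ArithmeticFunction.vonMangoldt n := by
  rcases eq_or_ne (Real.log n) 0 with h | h
  · have h1 := ArithmeticFunction.vonMangoldt_le_log (n := n)
    have h2 := ArithmeticFunction.vonMangoldt_nonneg (n := n)
    rw [h] at h1 ⊢
    linarith
  · rw [lz, div_mul_cancel₀ _ h]

lemma lz_nonneg (n : ℕ) : 0 ≤ lz n :=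
  div_nonneg ArithmeticFunction.vonMangoldt_nonneg (log_nat_nonneg n)

lemma lz_le_one (n : ℕ) : lz n ≤ 1 :=
  div_le_one_of_le₀ ArithmeticFunction.vonMangoldt_le_log (log_nat_nonneg n)

lemma lz_absc : LSeries.abscissaOfAbsConv (fun n => (lz n : ℂ)) ≤ 1 := by
  apply LSeries.abscissaOfAbsConv_le_of_le_const
  refine ⟨1, fun n _ => ?_⟩
  rw [Complex.norm_real, Real.norm_of_nonneg (lz_nonneg n)]
  exact lz_le_one n

lemma lz_hasDerivAt {z : ℂ} (hz : 1 < z.re) :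
    HasDerivAt (LSeries (fun n => (lz n : ℂ))) (logDeriv riemannZeta z) z := by
  have h := LSeries_hasDerivAt (f := fun n => (lz n : ℂ)) (s := z)
    (lz_absc.trans_lt (by exact_mod_cast hz))
  rw [zeta_logDeriv hz]
  convert! h using 3
  ext n
  rw [LSeries.logMul, ← lz_mul_log, ← Complex.natCast_log]
  push_cast; ring

lemma zeta_exp {z : ℂ} (hz : 1 < z.re) :
    riemannZeta z = Complex.exp (LSeries (fun n => (lz n : ℂ)) z) := by
  set L := LSeries (fun n => (lz n : ℂ)) with hL
  set U : Set ℂ := {z | 1 < z.re} with hU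
  have hUo : IsOpen U := isOpen_lt continuous_const Complex.continuous_re
  have hUc : IsPreconnected U := (convex_halfSpace_re_gt 1).isPreconnected
  have hd : ∀ z ∈ U, HasDerivAt (fun z => riemannZeta z * Complex.exp (-L z)) 0 z := by
    intro z hz
    have hz1 : z ≠ 1 := by rintro rfl; simp [hU] at hz
    have hz0 := riemannZeta_ne_zero_of_one_lt_re hz
    have h1 := (differentiableAt_riemannZeta hz1).hasDerivAt
    have h2 := (lz_hasDerivAt hz).neg.cexp
    convert! h1.mul h2 using 1
    rw [logDeriv_apply]
    field_simp
    ring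
  have hconst : ∀ σ : ℝ, 1 < σ → riemannZeta z * Complex.exp (-L z) = riemannZeta σ * Complex.exp (-L σ) := by
    intro σ hσ
    exact hUo.is_const_of_deriv_eq_zero hUc (fun w hw => (hd w hw).differentiableAt.differentiableWithinAt)
      (fun w hw => (hd w hw).deriv) hz (by simpa [hU] using hσ)
  have hL0 : Tendsto (fun σ : ℝ => L σ) atTop (𝓝 0) := by
    have := LSeries.tendsto_atTop (f := fun n => (lz n : ℂ)) (lz_absc.trans_lt (by exact EReal.coe_lt_top 1))
    simpa [lz_one] using this
  have hZ0 : Tendsto (fun σ : ℝ => riemannZeta σ) atTop (𝓝 1) := by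
    have := LSeries.tendsto_atTop (f := (1 : ℕ → ℂ)) (by
      rw [LSeries.abscissaOfAbsConv_one]; exact EReal.coe_lt_top 1)
    rw [Pi.one_apply] at this
    refine this.congr' ?_
    filter_upwards [eventually_gt_atTop 1] with σ hσ
    exact LSeries_one_eq_riemannZeta (by simpa using hσ)
  have hlim : Tendsto (fun σ : ℝ => riemannZeta σ * Complex.exp (-L σ)) atTop (𝓝 (1 * Complex.exp (-0))) :=
    hZ0.mul ((Complex.continuous_exp.tendsto _).comp hL0.neg)
  have hc : Tendsto (fun σ : ℝ => riemannZeta σ * Complex.exp (-L σ)) atTop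
      (𝓝 (riemannZeta z * Complex.exp (-L z))) := by
    refine tendsto_const_nhds.congr' ?_
    filter_upwards [eventually_gt_atTop 1] with σ hσ
    exact hconst σ hσ
  have := tendsto_nhds_unique hc hlim
  rw [neg_zero, Complex.exp_zero, mul_one, Complex.exp_neg] at this
  field_simp at this
  exact this

lemma lz_hasSum {s : ℝ} (hs : 1 < s) :
    HasSum (fun n => lz n * Real.exp (-s * Real.log n)) (Real.log (riemannZeta s).re) := by
  have hS : LSeriesSummable (fun n => (lz n : ℂ)) s :=
    LSeriesSummable_of_abscissaOfAbsConv_lt_re (lz_absc.trans_lt (by rw [ofReal_re]; exact_mod_cast hs))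
  have h' : Summable (fun n => lz n * Real.exp (-s * Real.log n)) := by
    have := (Complex.hasSum_re hS.hasSum).summable
    simpa only [term_real lz lz_zero, ofReal_re] using this
  have hz := zeta_exp (z := s) (by simpa using hs)
  rw [LSeries] at hz
  simp only [term_real lz lz_zero] at hz
  rw [← Complex.ofReal_tsum, ← Complex.ofReal_exp] at hz
  rw [hz, ofReal_re, Real.log_exp]
  exact h'.hasSum

lemma vm_hasSum {s : ℝ} (hs : 1 < s) :
    HasSum (fun n => ArithmeticFunction.vonMangoldt n * Real.exp (-s * Real.log n))
      (-(deriv riemannZeta s / riemannZeta s).re) := by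
  have hS := (ArithmeticFunction.LSeriesSummable_vonMangoldt (s := (s:ℂ)) (by simpa using hs)).hasSum
  have h := zeta_logDeriv (s := (s:ℂ)) (by simpa using hs)
  rw [← logDeriv_apply, h, neg_re, neg_neg, LSeries]
  have := Complex.hasSum_re hS
  simp only [term_real (fun n => ArithmeticFunction.vonMangoldt n) (by simp), ofReal_re] at this
  convert! this using 3
  simp only [term_real (fun n => ArithmeticFunction.vonMangoldt n) (by simp)]

lemma lg_int : ∫ t in Ioi (0:ℝ), Real.log t * Real.exp (-t) = -Real.eulerMascheroniConstant := by
  have h := Complex.hasDerivAt_GammaIntegral (s := 1) (by simp)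
  have h2 : HasDerivAt Complex.GammaIntegral (-(Real.eulerMascheroniConstant : ℂ)) 1 := by
    refine Complex.hasDerivAt_Gamma_one.congr_of_eventuallyEq ?_
    have : IsOpen {s : ℂ | 0 < s.re} := isOpen_lt continuous_const Complex.continuous_re
    filter_upwards [this.mem_nhds (show (1:ℂ) ∈ {s : ℂ | 0 < s.re} by simp)] with s hs
    exact (Complex.Gamma_eq_integral hs).symm
  have h3 := h.unique h2
  have h4 : ∫ t : ℝ in Ioi 0, (t:ℂ) ^ ((1:ℂ) - 1) * (Real.log t * Real.exp (-t)) =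
      ((∫ t in Ioi (0:ℝ), Real.log t * Real.exp (-t) : ℝ) : ℂ) := by
    refine Eq.trans ?_ (integral_ofReal (𝕜 := ℂ))
    refine integral_congr_ae (Eventually.of_forall fun t => ?_)
    simp
  rw [h4] at h3
  exact_mod_cast h3

lemma lg_integrable : IntegrableOn (fun t : ℝ => Real.log t * Real.exp (-t)) (Ioi 0) := by
  by_contra h
  have h1 := integral_undef h
  rw [lg_int] at h1
  have := Real.one_half_lt_eulerMascheroniConstant
  linarith

lemma lg_u {u : ℝ} (hu : 0 < u) :
    IntegrableOn (fun r : ℝ => Real.log r * Real.exp (-(u * r))) (Ioi 0) ∧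
    ∫ r in Ioi (0:ℝ), Real.log r * Real.exp (-(u * r)) =
      (-Real.eulerMascheroniConstant - Real.log u) / u := by
  have hi := (integrableOn_Ioi_comp_mul_left_iff (fun t : ℝ => Real.log t * Real.exp (-t)) 0 hu).2
    (by rw [mul_zero]; exact lg_integrable)
  have hI := integral_comp_mul_left_Ioi (fun t : ℝ => Real.log t * Real.exp (-t)) 0 hu
  rw [mul_zero, lg_int] at hI
  have hE : IntegrableOn (fun r : ℝ => Real.exp (-u * r)) (Ioi 0) := integrableOn_exp_mul_Ioi (by linarith) 0
  have hEI := integral_exp_mul_Ioi (a := -u) (by linarith) 0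
  have heq : ∀ r ∈ Ioi (0:ℝ), Real.log (u * r) * Real.exp (-(u * r)) - Real.log u * Real.exp (-u * r) =
      Real.log r * Real.exp (-(u * r)) := by
    intro r hr
    rw [Real.log_mul hu.ne' (ne_of_gt hr), neg_mul]; ring
  constructor
  · exact (hi.sub (hE.const_mul _)).congr_fun heq measurableSet_Ioi
  · rw [← setIntegral_congr_fun measurableSet_Ioi heq, integral_sub hi (hE.const_mul _), hI,
      integral_const_mul, hEI]
    simp
    field_simp

/-- The pole integral. -/
noncomputable def eI (u δ : ℝ) : ℝ := ∫ r in Ioi δ, Real.exp (-(u * r)) / r ^ 2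

lemma eI_integrable {u δ : ℝ} (hu : 0 < u) (hδ : 0 < δ) :
    IntegrableOn (fun r : ℝ => Real.exp (-(u * r)) / r ^ 2) (Ioi δ) := by
  have hE : IntegrableOn (fun r : ℝ => Real.exp (-u * r)) (Ioi δ) := integrableOn_exp_mul_Ioi (by linarith) δ
  refine Integrable.mono' (hE.const_mul (1 / δ ^ 2)) ?_ ?_
  · refine ContinuousOn.aestronglyMeasurable ?_ measurableSet_Ioi
    refine ContinuousOn.div (by fun_prop) (by fun_prop) fun r hr => ?_
    have : 0 < r := hδ.trans hr
    positivity
  · filter_upwards [ae_restrict_mem measurableSet_Ioi] with r hr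
    have hr' : δ < r := hr
    have : 0 < r := hδ.trans hr
    rw [Real.norm_of_nonneg (by positivity), neg_mul, div_eq_mul_one_div, mul_comm]
    gcongr

lemma eI_eq {u δ : ℝ} (hu : 0 < u) (hδ : 0 < δ) :
    eI u δ = Real.exp (-(u * δ)) / δ + u * (Real.exp (-(u * δ)) * Real.log δ) -
      u ^ 2 * ∫ r in Ioi δ, Real.log r * Real.exp (-(u * r)) := by
  have hl : IntegrableOn (fun r : ℝ => Real.log r * Real.exp (-(u * r))) (Ioi δ) :=
    (lg_u hu).1.mono_set (Ioi_subset_Ioi hδ.le)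
  have he := eI_integrable hu hδ
  have hder : ∀ x ∈ Ici δ, HasDerivAt (fun r => -(Real.exp (-(u * r)) / r + u * (Real.exp (-(u * r)) * Real.log r)))
      (Real.exp (-(u * x)) / x ^ 2 + u ^ 2 * (Real.log x * Real.exp (-(u * x)))) x := by
    intro x hx
    have hx0 : 0 < x := lt_of_lt_of_le hδ hx
    have h1 : HasDerivAt (fun r => Real.exp (-(u * r))) (Real.exp (-(u * x)) * (-(u * 1))) x :=
      (((hasDerivAt_id x).const_mul u).neg).exp
    have h2 := h1.div (hasDerivAt_id x) hx0.ne'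
    have h3 := (h1.mul (Real.hasDerivAt_log hx0.ne')).const_mul u
    convert! (h2.add h3).neg using 1
    simp only [id]
    field_simp
    ring
  have hlim : Tendsto (fun r => -(Real.exp (-(u * r)) / r + u * (Real.exp (-(u * r)) * Real.log r))) atTop (𝓝 0) := by
    have h1 : Tendsto (fun r : ℝ => Real.exp (-(u * r))) atTop (𝓝 0) :=
      Real.tendsto_exp_neg_atTop_nhds_zero.comp (tendsto_id.const_mul_atTop hu)
    have h2 : Tendsto (fun r : ℝ => Real.exp (-(u * r)) / r) atTop (𝓝 0) := h1.div_atTop tendsto_id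
    have h3 : Tendsto (fun r : ℝ => Real.exp (-(u * r)) * Real.log r) atTop (𝓝 0) := by
      have h4 : (fun r : ℝ => Real.log r) =o[atTop] fun r => r ^ (1:ℝ) := isLittleO_log_rpow_atTop one_pos
      have h5 := (isLittleO_exp_neg_mul_rpow_atTop hu (-1)).isBigO.mul_isLittleO h4
      have h6 : (fun r : ℝ => r ^ (-1:ℝ) * r ^ (1:ℝ)) =ᶠ[atTop] fun _ => (1:ℝ) := by
        filter_upwards [eventually_gt_atTop 0] with r hr
        rw [← Real.rpow_add hr]; simp
      have h7 := (h5.congr' (by rfl) h6).tendsto_div_nhds_zero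
      simpa using h7
    have := (h2.add (h3.const_mul u)).neg
    simpa using this
  have := integral_Ioi_of_hasDerivAt_of_tendsto' hder (he.add (hl.const_mul _)) hlim
  rw [integral_add he (hl.const_mul _), integral_const_mul] at this
  rw [eI]
  linarith

lemma lg_tendsto {u : ℝ} (hu : 0 < u) :
    Tendsto (fun δ => ∫ r in Ioi δ, Real.log r * Real.exp (-(u * r))) (𝓝[>] 0)
      (𝓝 ((-Real.eulerMascheroniConstant - Real.log u) / u)) := by
  rw [← (lg_u hu).2]
  have hc : AECover (volume.restrict (Ioi (0:ℝ))) (𝓝[>] (0:ℝ)) fun δ => Ioi δ :=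
    aecover_Ioi_of_Ioi (tendsto_id.mono_left nhdsWithin_le_nhds)
  refine (hc.integral_tendsto_of_countably_generated (lg_u hu).1).congr' ?_
  filter_upwards [self_mem_nhdsWithin] with δ hδ
  rw [Measure.restrict_restrict measurableSet_Ioi, inter_eq_self_of_subset_left (Ioi_subset_Ioi (le_of_lt hδ))]

lemma tl_int {u δ : ℝ} (hu : 0 < u) (n : ℕ) :
    IntegrableOn (fun r => tl u (1 + r) n) (Ioi δ) ∧
    ∫ r in Ioi δ, tl u (1 + r) n = tl u (1 + δ) n / Real.log n := by
  rcases le_or_gt (Real.log n) u with h | h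
  · have : ∀ r, tl u r n = 0 := fun r => by rw [tl, max_eq_right (by linarith)]; ring
    simp [this]
  · have hl : 0 < Real.log n := hu.trans h
    have e : ∀ r, tl u (1 + r) n = (ArithmeticFunction.vonMangoldt n * Real.exp (-Real.log n) *
        max (Real.log n - u) 0) * Real.exp (-Real.log n * r) := by
      intro r
      rw [tl, show -(1 + r) * Real.log n = -Real.log n + -Real.log n * r by ring, Real.exp_add]
      ring
    simp only [e]
    refine ⟨(integrableOn_exp_mul_Ioi (by linarith) δ).const_mul _, ?_⟩
    rw [integral_const_mul, integral_exp_mul_Ioi (by linarith) δ]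
    field_simp

lemma tl_tail (RH : RiemannHypothesis) {u δ : ℝ} (hu : 0 < u) (hδ : 0 < δ) (F : Finset ℕ) :
    ∑ n ∈ F, tl u (1 + δ) n / Real.log n ≤ eI u δ + 2 * |Bconst| * Real.exp (-(u * (δ + 1 / 2))) / u := by
  have hE : IntegrableOn (fun r : ℝ => Real.exp (-u * r)) (Ioi δ) := integrableOn_exp_mul_Ioi (by linarith) δ
  have hEI := integral_exp_mul_Ioi (a := -u) (by linarith) δ
  have h1 : ∑ n ∈ F, tl u (1 + δ) n / Real.log n = ∫ r in Ioi δ, ∑ n ∈ F, tl u (1 + r) n := by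
    rw [integral_finsetSum _ fun n _ => (tl_int hu n).1]
    exact Finset.sum_congr rfl fun n _ => (tl_int hu n).2.symm
  have h2 : ∫ r in Ioi δ, ∑ n ∈ F, tl u (1 + r) n ≤ ∫ r in Ioi δ, (Real.exp (-(u * r)) / r ^ 2 +
      (2 * |Bconst| * Real.exp (-(u * (1 / 2)))) * Real.exp (-u * r)) := by
    refine setIntegral_mono_on (integrable_finsetSum _ fun n _ => (tl_int hu n).1)
      ((eI_integrable hu hδ).add (hE.const_mul _)) measurableSet_Ioi fun r hr => ?_
    have hr0 : 0 < r := hδ.trans hr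
    obtain ⟨hS, hle⟩ := tl_le RH hu.le (s := 1 + r) (by linarith)
    refine (hS.sum_le_tsum F fun n _ => tl_nonneg _ _ _).trans (hle.trans (le_of_eq ?_))
    rw [show 1 + r - 1 = r by ring, show -(u * (1 + r - 1 / 2)) = -(u * (1 / 2)) + -u * r by ring, Real.exp_add]
    ring
  rw [h1]
  refine h2.trans (le_of_eq ?_)
  rw [integral_add (eI_integrable hu hδ) (hE.const_mul _), integral_const_mul, hEI, eI,
    show -(u * (δ + 1 / 2)) = -(u * (1 / 2)) + -u * δ by ring, Real.exp_add]
  field_simp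

lemma key_ineq (RH : RiemannHypothesis) {u δ : ℝ} (hu : 0 < u) (hδ : 0 < δ) {F : Finset ℕ}
    (hF : ∀ n ∉ F, u < Real.log n ∨ n = 0) (hF' : ∀ n ∈ F, Real.log n ≤ u) :
    ∑ n ∈ F, lz n * Real.exp (-(1 + δ) * Real.log n) * (u - Real.log n) ≤
      u * Real.log (riemannZeta ((1 + δ : ℝ) : ℂ)).re +
        (deriv riemannZeta ((1 + δ : ℝ) : ℂ) / riemannZeta ((1 + δ : ℝ) : ℂ)).re +
        (eI u δ + 2 * |Bconst| * Real.exp (-(u * (δ + 1 / 2))) / u) := by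
  set s := 1 + δ with hs
  have hs1 : 1 < s := by linarith
  have h1 := ((lz_hasSum hs1).mul_left u).sub (vm_hasSum hs1)
  have h2 : HasSum (fun n => lz n * Real.exp (-s * Real.log n) * (u - Real.log n))
      (u * Real.log (riemannZeta (s : ℂ)).re + (deriv riemannZeta (s : ℂ) / riemannZeta (s : ℂ)).re) := by
    rw [← sub_neg_eq_add]
    refine h1.congr_fun ?_
    intro n
    rw [← lz_mul_log]; ring
  have h3 : Summable fun n => tl u s n / Real.log n :=
    summable_of_sum_le (fun n => div_nonneg (tl_nonneg _ _ _) (log_nat_nonneg n)) (tl_tail RH hu hδ)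
  have h4 : ∑' n, tl u s n / Real.log n ≤ eI u δ + 2 * |Bconst| * Real.exp (-(u * (δ + 1 / 2))) / u :=
    Real.tsum_le_of_sum_le (fun n => div_nonneg (tl_nonneg _ _ _) (log_nat_nonneg n)) (tl_tail RH hu hδ)
  have h5 := h2.add h3.hasSum
  have e1 : ∀ n, tl u s n / Real.log n = lz n * Real.exp (-s * Real.log n) * max (Real.log n - u) 0 := by
    intro n; rw [tl, lz]; ring
  have h6 : ∑ n ∈ F, lz n * Real.exp (-s * Real.log n) * (u - Real.log n) =
      ∑' n, (lz n * Real.exp (-s * Real.log n) * (u - Real.log n) + tl u s n / Real.log n) := by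
    rw [tsum_eq_sum (s := F)]
    · refine Finset.sum_congr rfl fun n hn => ?_
      rw [e1, max_eq_right (by linarith [hF' n hn])]; ring
    · intro n hn
      rw [e1]
      rcases hF n hn with h | rfl
      · rw [max_eq_left (by linarith)]; ring
      · simp [lz_zero]
  rw [h6, h5.tsum_eq]
  linarith

lemma rhs_tendsto {u : ℝ} (hu : 0 < u) :
    Tendsto (fun δ : ℝ => u * Real.log (riemannZeta ((1 + δ : ℝ) : ℂ)).re +
        (deriv riemannZeta ((1 + δ : ℝ) : ℂ) / riemannZeta ((1 + δ : ℝ) : ℂ)).re +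
        (eI u δ + 2 * |Bconst| * Real.exp (-(u * (δ + 1 / 2))) / u)) (𝓝[>] 0)
      (𝓝 (u * Real.log u + (Real.eulerMascheroniConstant - 1) * u + Real.eulerMascheroniConstant +
        2 * |Bconst| * Real.exp (-(u / 2)) / u)) := by
  have hsh : Tendsto (fun δ : ℝ => 1 + δ) (𝓝[>] 0) (𝓝[>] 1) := by
    refine tendsto_nhdsWithin_iff.2 ⟨?_, ?_⟩
    · have : Tendsto (fun δ : ℝ => 1 + δ) (𝓝 0) (𝓝 (1 + 0)) :=
        Continuous.tendsto (by fun_prop) 0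
      rw [add_zero] at this
      exact this.mono_left nhdsWithin_le_nhds
    · filter_upwards [self_mem_nhdsWithin] with δ hδ
      have : 0 < δ := hδ
      simp only [mem_Ioi]; linarith
  have t1 : Tendsto (fun δ : ℝ => Real.log (riemannZeta ((1 + δ : ℝ) : ℂ)).re + Real.log δ) (𝓝[>] 0) (𝓝 0) := by
    have := (log_riemannZeta_add_log_sub_isLittleO_ofReal).tendsto_div_nhds_zero.comp hsh
    simpa [Function.comp_def] using this
  have hshC : Tendsto (fun δ : ℝ => ((1 + δ : ℝ) : ℂ)) (𝓝[>] 0) (𝓝[≠] 1) := by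
    refine tendsto_nhdsWithin_iff.2 ⟨?_, ?_⟩
    · have : Tendsto (fun δ : ℝ => ((1 + δ : ℝ) : ℂ)) (𝓝 0) (𝓝 ((1 + 0 : ℝ) : ℂ)) :=
        Continuous.tendsto (f := fun δ : ℝ => ((1 + δ : ℝ) : ℂ)) (by fun_prop) 0
      rw [add_zero, ofReal_one] at this
      exact this.mono_left nhdsWithin_le_nhds
    · filter_upwards [self_mem_nhdsWithin] with δ hδ
      have : 0 < δ := hδ
      simp [this.ne']
  have t2 : Tendsto (fun δ : ℝ => (deriv riemannZeta ((1 + δ : ℝ) : ℂ) / riemannZeta ((1 + δ : ℝ) : ℂ)).re + 1 / δ)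
      (𝓝[>] 0) (𝓝 Real.eulerMascheroniConstant) := by
    have h := (log_deriv_riemannZeta_add_inv_sub_sub_isLittleO).tendsto_div_nhds_zero.comp hshC
    have h' := ((Complex.continuous_re.tendsto _).comp h).add_const Real.eulerMascheroniConstant
    rw [zero_re, zero_add] at h'
    refine h'.congr fun δ => ?_
    simp only [Function.comp_def, div_one]
    rw [show (((1 + δ : ℝ) : ℂ) - 1)⁻¹ = ((1 / δ : ℝ) : ℂ) by push_cast; simp, sub_re, add_re, ofReal_re, ofReal_re]
    ring
  have t3 : Tendsto (fun δ : ℝ => (Real.exp (-(u * δ)) - 1) / δ) (𝓝[>] 0) (𝓝 (-u)) := by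
    have h1 : HasDerivAt (fun r => Real.exp (-(u * r))) (Real.exp (-(u * 0)) * (-(u * 1))) 0 :=
      (((hasDerivAt_id (0:ℝ)).const_mul u).neg).exp
    have h2 := (hasDerivAt_iff_tendsto_slope.1 h1).mono_left
      (nhdsWithin_mono 0 (fun δ (hδ : 0 < δ) => ne_of_gt hδ) : 𝓝[>] (0:ℝ) ≤ 𝓝[≠] 0)
    simp only [mul_zero, neg_zero, Real.exp_zero, mul_one, one_mul] at h2
    refine h2.congr fun δ => ?_
    simp [slope_def_field]
  have t4 : Tendsto (fun δ : ℝ => Real.log δ * δ) (𝓝[>] 0) (𝓝 0) :=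
    by simpa using tendsto_log_mul_rpow_nhdsGT_zero one_pos
  have t5 := lg_tendsto hu
  have t6 : Tendsto (fun δ : ℝ => 2 * |Bconst| * Real.exp (-(u * (δ + 1 / 2))) / u) (𝓝[>] 0)
      (𝓝 (2 * |Bconst| * Real.exp (-(u * (0 + 1 / 2))) / u)) := by
    have : Continuous (fun δ : ℝ => 2 * |Bconst| * Real.exp (-(u * (δ + 1 / 2))) / u) := by fun_prop
    exact (this.tendsto 0).mono_left nhdsWithin_le_nhds
  have tt := (((((t1.const_mul u).add t2).add t3).add ((t3.mul t4).const_mul u)).sub (t5.const_mul (u ^ 2))).add t6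
  have ev : u * 0 + Real.eulerMascheroniConstant + -u + u * (-u * 0) -
      u ^ 2 * ((-Real.eulerMascheroniConstant - Real.log u) / u) +
      2 * |Bconst| * Real.exp (-(u * (0 + 1 / 2))) / u =
      u * Real.log u + (Real.eulerMascheroniConstant - 1) * u + Real.eulerMascheroniConstant +
        2 * |Bconst| * Real.exp (-(u / 2)) / u := by
    rw [show u * (0 + 1 / 2) = u / 2 by ring]
    field_simp
    ring
  rw [ev] at tt
  refine tt.congr' ?_
  filter_upwards [self_mem_nhdsWithin] with δ hδ
  have hδ' : 0 < δ := hδ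
  rw [eI_eq hu hδ']
  field_simp
  ring

lemma main_ineq (RH : RiemannHypothesis) {u : ℝ} (hu : 0 < u) {F : Finset ℕ}
    (hF : ∀ n ∉ F, u < Real.log n ∨ n = 0) (hF' : ∀ n ∈ F, Real.log n ≤ u) :
    ∑ n ∈ F, lz n * Real.exp (-Real.log n) * (u - Real.log n) ≤
      u * Real.log u + (Real.eulerMascheroniConstant - 1) * u + Real.eulerMascheroniConstant +
        2 * |Bconst| * Real.exp (-(u / 2)) / u := by
  have hl : Tendsto (fun δ : ℝ => ∑ n ∈ F, lz n * Real.exp (-(1 + δ) * Real.log n) * (u - Real.log n)) (𝓝[>] 0)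
      (𝓝 (∑ n ∈ F, lz n * Real.exp (-(1 + 0) * Real.log n) * (u - Real.log n))) := by
    have : Continuous (fun δ : ℝ => ∑ n ∈ F, lz n * Real.exp (-(1 + δ) * Real.log n) * (u - Real.log n)) := by
      fun_prop
    exact (this.tendsto 0).mono_left nhdsWithin_le_nhds
  simp only [add_zero, neg_mul, one_mul] at hl
  refine le_of_tendsto_of_tendsto hl (rhs_tendsto hu) ?_
  filter_upwards [self_mem_nhdsWithin] with δ hδ
  have := key_ineq RH hu hδ hF hF'
  simpa only [neg_mul] using this

end Helpers

/-- Assuming the Riemann hypothesis, for all real `x ≥ e`,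
`Σ_{n≤x} (Λ(n)/(n log n)) log(x/n)/log x ≤ log log x + γ − 1 + γ/log x + 2|B|/(√x log²x)`. -/
theorem sum_vonMangoldt_weighted_upper (RH : RiemannHypothesis) (x : ℝ)
    (hx : Real.exp 1 ≤ x) :
    ∑ n ∈ Finset.Icc 1 ⌊x⌋₊,
        ArithmeticFunction.vonMangoldt n / (n * Real.log n) * (Real.log (x / n) / Real.log x)
      ≤ Real.log (Real.log x) + Real.eulerMascheroniConstant - 1
        + Real.eulerMascheroniConstant / Real.log x
        + 2 * |Bconst| / (Real.sqrt x * (Real.log x) ^ 2) := by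
  have hx0 : 0 < x := (Real.exp_pos 1).trans_le hx
  have hu1 : 1 ≤ Real.log x := (Real.le_log_iff_exp_le hx0).2 hx
  set u := Real.log x with hu
  have hu0 : 0 < u := by linarith
  have h := main_ineq RH hu0 (F := Finset.Icc 1 ⌊x⌋₊) (by
    intro n hn
    rcases Nat.eq_zero_or_pos n with h | h
    · exact Or.inr h
    · left
      apply Real.log_lt_log hx0
      by_contra hc
      exact hn (Finset.mem_Icc.2 ⟨h, Nat.le_floor (not_lt.1 hc)⟩)) (by
    intro n hn
    rw [Finset.mem_Icc] at hn
    exact Real.log_le_log (by exact_mod_cast hn.1) ((Nat.le_floor_iff hx0.le).1 hn.2))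
  have hsq : Real.exp (-(u / 2)) = 1 / Real.sqrt x := by
    rw [Real.exp_neg, ← Real.log_sqrt hx0.le, Real.exp_log (Real.sqrt_pos.2 hx0), one_div]
  have hL : ∑ n ∈ Finset.Icc 1 ⌊x⌋₊,
        ArithmeticFunction.vonMangoldt n / (n * Real.log n) * (Real.log (x / n) / u) =
      (∑ n ∈ Finset.Icc 1 ⌊x⌋₊, lz n * Real.exp (-Real.log n) * (u - Real.log n)) / u := by
    rw [Finset.sum_div]
    refine Finset.sum_congr rfl fun n hn => ?_
    rw [Finset.mem_Icc] at hn
    have hn0 : (0:ℝ) < n := by exact_mod_cast hn.1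
    rw [Real.log_div hx0.ne' hn0.ne', Real.exp_neg, Real.exp_log hn0, lz, ← hu, div_mul_eq_div_div,
      div_eq_mul_inv (_ / _) (Real.log n), div_eq_mul_inv _ (n:ℝ), div_eq_mul_inv _ (Real.log n)]
    ring
  rw [hL, div_le_iff₀ hu0]
  refine h.trans (le_of_eq ?_)
  rw [hsq]
  have := Real.sqrt_pos.2 hx0
  field_simp
  ring
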